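/- Let K be a number field with ring of integers 𝓞_K, let f ∈ 𝓞_K[x] with deg f = d ≥ 2, fix an integer n ≥ 1, let K_n be a splitting field of f^{∘n}(x) − t over K(t), and let G_n = Gal(K_n/K(t)), acting on the set of roots of f^{∘n}(x) − t in K_n. Assume K is algebraically closed in K_n. Then for every δ > 0 there is a constant M such that for every nonzero prime ideal 𝔭 of 𝓞_K with N(𝔭) > M and with the leading coefficient of f not in 𝔭, one has #Per(f_𝔭) + 1 ≤ (FPP(G_n) + δ)·(N(𝔭) + 1). (The '+1' on the left accounts for the fixed point at infinity of the polynomial map on the projective line.) -/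

import Mathlib

open NumberField Polynomial

/-- The number of periodic points of the self-map of `R ⧸ I` induced by a polynomial
`f ∈ R[x]` (reduce the coefficients of `f` modulo `I` and iterate evaluation). -/
noncomputable def perCount {R : Type*} [CommRing R] (f : Polynomial R) (I : Ideal R) : ℕ :=
  Set.ncard {z : R ⧸ I | ∃ m : ℕ, 0 < m ∧
    (fun w => (f.map (Ideal.Quotient.mk I)).eval w)^[m] z = z}

/-- `FPP h` is the proportion of elements of the Galois group of (a splitting field of)
`h` that fix at least one root of `h`. -/
noncomputable def FPP {F : Type*} [Field F] (h : Polynomial F) : ℝ :=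
  (Nat.card {σ : h.Gal // ∃ x : h.SplittingField, Polynomial.aeval x h = 0 ∧ σ x = x} : ℝ) /
    (Nat.card h.Gal : ℝ)

/-- `iterMinusT K f n` is the polynomial `f^{∘n}(x) − t` over `K(t)`, for
`f ∈ 𝓞_K[x]`. -/
noncomputable def iterMinusT (K : Type*) [Field K] [NumberField K]
    (f : Polynomial (𝓞 K)) (n : ℕ) : Polynomial (RatFunc K) :=
  ((fun g => f.comp g)^[n] Polynomial.X).map
      ((algebraMap K (RatFunc K)).comp (algebraMap (𝓞 K) K)) -
    Polynomial.C RatFunc.X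

/-- The embedding of the constant field `K` into a splitting field of a polynomial
over `K(t)`. -/
noncomputable def constEmb (K : Type*) [Field K] [NumberField K]
    (h : Polynomial (RatFunc K)) : K →+* h.SplittingField :=
  (algebraMap (RatFunc K) h.SplittingField).comp (algebraMap K (RatFunc K))

/-- `x` vanishes to order `k` at `Q` with respect to the derivation `E`. -/
def StVan {O R : Type*} [CommRing O] [CommRing R] [Algebra O R] (E : Derivation O R R)
    (Q : Ideal R) (k : ℕ) (x : R) : Prop := ∀ l < k, E^[l] x ∈ Q

section van
variable {O R : Type*} [CommRing O] [CommRing R] [Algebra O R] {E : Derivation O R R}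
    {Q : Ideal R}

theorem StVan.succ_iff {k : ℕ} {x : R} :
    StVan E Q (k + 1) x ↔ x ∈ Q ∧ StVan E Q k (E x) := by
  constructor
  · intro h
    refine ⟨h 0 (by omega), fun l hl => ?_⟩
    have := h (l + 1) (by omega)
    rwa [Function.iterate_succ_apply] at this
  · rintro ⟨h0, h1⟩ l hl
    cases l with
    | zero => exact h0
    | succ l =>
      rw [Function.iterate_succ_apply]
      exact h1 l (by omega)

theorem stIter_add (E : Derivation O R R) (l : ℕ) (x y : R) :
    E^[l] (x + y) = E^[l] x + E^[l] y :=
  iterate_map_add E l x y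

theorem StVan.add {k : ℕ} {x y : R} (hx : StVan E Q k x) (hy : StVan E Q k y) :
    StVan E Q k (x + y) := by
  intro l hl
  rw [stIter_add]
  exact Q.add_mem (hx l hl) (hy l hl)

theorem StVan.mono {k j : ℕ} {x : R} (hx : StVan E Q k x) (h : j ≤ k) : StVan E Q j x :=
  fun l hl => hx l (by omega)

theorem StVan.mul_aux (n : ℕ) : ∀ (k j : ℕ) (x y : R), k + j = n → StVan E Q k x →
    StVan E Q j y → StVan E Q n (x * y) := by
  induction n with
  | zero => intro k j x y _ _ _ l hl; omega
  | succ n ih =>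
    intro k j x y h hx hy
    rw [StVan.succ_iff]
    constructor
    · rcases Nat.eq_zero_or_pos k with rfl | hk
      · exact Q.mul_mem_left _ (hy 0 (by omega))
      · exact Q.mul_mem_right _ (hx 0 (by omega))
    · rw [E.leibniz, smul_eq_mul, smul_eq_mul]
      apply StVan.add
      · rcases j with _ | j
        · exact ih n 0 x (E y) (by omega) (hx.mono (by omega)) (fun l hl => by omega)
        · exact ih k j x (E y) (by omega) hx (StVan.succ_iff.1 hy).2
      · rcases k with _ | k
        · exact ih n 0 y (E x) (by omega) (hy.mono (by omega)) (fun l hl => by omega)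
        · exact ih j k y (E x) (by omega) hy (StVan.succ_iff.1 hx).2

theorem StVan.mul {k j : ℕ} {x y : R} (hx : StVan E Q k x) (hy : StVan E Q j y) :
    StVan E Q (k + j) (x * y) := StVan.mul_aux _ k j x y rfl hx hy

theorem StVan.prod {ι : Type*} (s : Finset ι) (k : ι → ℕ) (x : ι → R)
    (h : ∀ i ∈ s, StVan E Q (k i) (x i)) : StVan E Q (∑ i ∈ s, k i) (∏ i ∈ s, x i) := by
  classical
  induction s using Finset.induction_on with
  | empty => intro l hl; simp at hl
  | insert a s ha ih =>
    rw [Finset.sum_insert ha, Finset.prod_insert ha]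
    exact (h a (by simp)).mul (ih fun i hi => h i (by simp [hi]))

end van

section mult
variable {k : Type*} [Field k]

theorem st_mult_aux (e : k[X]) (a : k) (j : ℕ) : ∀ Q : k[X],
    eval a ((fun P => e * derivative P)^[j] ((X - C a) ^ j * Q)) =
      (j.factorial : k) * (eval a e) ^ j * eval a Q := by
  induction j with
  | zero => intro Q; simp
  | succ j ih =>
    intro Q
    rw [Function.iterate_succ_apply]
    have : e * derivative ((X - C a) ^ (j + 1) * Q) =
        (X - C a) ^ j * (e * (C ((j : k) + 1) * Q + (X - C a) * derivative Q)) := by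
      rw [derivative_mul, derivative_X_sub_C_pow]
      simp only [Nat.add_sub_cancel, map_add, map_natCast, map_one, Nat.cast_add, Nat.cast_one]
      ring
    rw [this, ih]
    simp only [eval_mul, eval_add, eval_C, eval_sub, eval_X, sub_self, zero_mul, add_zero,
      Nat.factorial_succ, Nat.cast_mul, Nat.cast_add, Nat.cast_one]
    ring

theorem st_mult (e : k[X]) (a : k) (he : eval a e ≠ 0) (n : ℕ) (hn : (n.factorial : k) ≠ 0)
    (P : k[X]) (h : ∀ l < n, eval a ((fun P => e * derivative P)^[l] P) = 0) :
    (X - C a) ^ n ∣ P := by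
  suffices ∀ j ≤ n, (X - C a) ^ j ∣ P from this n le_rfl
  intro j
  induction j with
  | zero => intro _; simp
  | succ j ih =>
    intro hj
    obtain ⟨Q, hQ⟩ := ih (by omega)
    have h1 := h j (by omega)
    rw [hQ, st_mult_aux] at h1
    have hf : (j.factorial : k) ≠ 0 := by
      intro h0
      apply hn
      obtain ⟨c, hc⟩ := Nat.factorial_dvd_factorial (show j ≤ n by omega)
      rw [hc, Nat.cast_mul, h0, zero_mul]
    have : eval a Q = 0 := by
      rcases mul_eq_zero.1 h1 with h2 | h2
      · exact absurd h2 (mul_ne_zero hf (pow_ne_zero _ he))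
      · exact h2
    obtain ⟨Q', hQ'⟩ := dvd_iff_isRoot.2 this
    exact ⟨Q', by rw [hQ, hQ', pow_succ]; ring⟩
end mult

section leftinv

theorem st_leftinv {R I J : Type*} [CommRing R] [IsDomain R] [Fintype I] [DecidableEq I]
    (a : J → I → R) (h : ∀ y : I → R, (∀ j, ∑ i, a j i * y i = 0) → y = 0) (i0 : I) :
    ∃ γ : R, γ ≠ 0 ∧ ∃ (s : Finset J) (b : J → R),
      ∀ i, ∑ j ∈ s, b j * a j i = if i = i0 then γ else 0 := by
  classical
  let K := FractionRing R
  let v : J → I → K := fun j i => algebraMap R K (a j i)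
  have hinj : Function.Injective (algebraMap R K) := IsFractionRing.injective R K
  have htop : Submodule.span K (Set.range v) = ⊤ := by
    by_contra hne
    obtain ⟨f, hf0, hf⟩ := Submodule.exists_le_ker_of_lt_top _ (lt_top_iff_ne_top.2 hne)
    obtain ⟨d, hd⟩ := IsLocalization.exist_integer_multiples_of_finite (nonZeroDivisors R)
      (fun i : I => f (Pi.single i 1))
    choose y hy using hd
    have hfv : ∀ j, ∑ i, a j i * y i = 0 := by
      intro j
      apply hinj
      have h1 : f (v j) = 0 := hf (Submodule.subset_span ⟨j, rfl⟩)
      have h2 : f (v j) = ∑ i, v j i * f (Pi.single i 1) := by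
        conv_lhs => rw [pi_eq_sum_univ' (v j)]
        simp [map_sum]
      rw [map_sum, map_zero]
      simp only [map_mul, hy]
      calc ∑ i, algebraMap R K (a j i) * ((d : R) • f (Pi.single i 1))
          = (d : R) • ∑ i, v j i * f (Pi.single i 1) := by
            rw [Finset.smul_sum]
            exact Finset.sum_congr rfl fun i _ => by rw [mul_smul_comm]
        _ = 0 := by rw [← h2, h1, smul_zero]
    have hy0 := h y hfv
    apply hf0
    apply LinearMap.pi_ext'
    intro i
    ext
    have h3 := hy i
    rw [hy0] at h3
    simp only [Pi.zero_apply, map_zero] at h3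
    have h4 : (d : R) • f (Pi.single i 1) = 0 := h3.symm
    rw [Algebra.smul_def] at h4
    rcases mul_eq_zero.1 h4 with h5 | h5
    · exfalso
      have : (d : R) = 0 := hinj (by rw [h5, map_zero])
      exact nonZeroDivisors.ne_zero d.2 this
    · simpa using h5
  have hmem : (Pi.single i0 1 : I → K) ∈ Submodule.span K (Set.range v) := by
    rw [htop]; trivial
  rw [Finsupp.mem_span_range_iff_exists_finsupp] at hmem
  obtain ⟨c, hc⟩ := hmem
  obtain ⟨d, hd⟩ := IsLocalization.exist_integer_multiples (nonZeroDivisors R) c.support c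
  choose! b hb using hd
  refine ⟨d, nonZeroDivisors.ne_zero d.2, c.support, b, fun i => ?_⟩
  apply hinj
  have h1 := congrFun hc i
  rw [Finsupp.sum, Finset.sum_apply] at h1
  rw [map_sum]
  have h2 : ∀ j ∈ c.support, algebraMap R K (b j * a j i) = (d : R) • (c j • v j) i := by
    intro j hj
    rw [map_mul, hb j hj, Pi.smul_apply, smul_eq_mul, smul_mul_assoc]
  rw [Finset.sum_congr rfl h2, ← Finset.smul_sum, h1]
  by_cases hi : i = i0
  · subst hi; simp [Algebra.smul_def]
  · simp [hi]

end leftinv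

/-- The data needed for the Stepanov-type argument. -/
structure StSetup (O R G ι : Type*) [CommRing O] [CommRing R] [Algebra O R] [Algebra O[X] R]
    [IsScalarTower O O[X] R] [Group G] [Fintype G] [MulSemiringAction G R] where
  /-- the derivation -/
  E : Derivation O R R
  /-- the value of the derivation on the variable -/
  e : O[X]
  e_ne : e ≠ 0
  E_X : E (algebraMap O[X] R X) = algebraMap O[X] R e
  E_G : ∀ (σ : G) (x : R), E (σ • x) = σ • E x
  inj : Function.Injective (algebraMap O[X] R)
  const : ∀ x y : R, y ≠ 0 → x * E y = y * E x →
    ∃ a b : O, b ≠ 0 ∧ algebraMap O R b * x = algebraMap O R a * y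
  /-- a basis consisting of integral elements -/
  ω : ι → R
  ω_ind : LinearIndependent O[X] ω
  ω_ded : ∀ y : G → R, (∀ j, ∑ τ, (τ • ω j) * y τ = 0) → y = 0
  /-- the weight predicate -/
  W : R → ℕ → Prop
  W_add : ∀ x y n, W x n → W y n → W (x + y) n
  W_mul : ∀ x y m n, W x m → W y n → W (x * y) (m + n)
  W_mono : ∀ x m n, m ≤ n → W x m → W x n
  W_G : ∀ (σ : G) x n, W x n → W (σ • x) n
  W_const : ∀ c : O, W (algebraMap O R c) 0
  W_deg : ∀ (P : O[X]) n, W (algebraMap O[X] R P) n → P.natDegree ≤ n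
  /-- the weight constant -/
  w : ℕ
  W_E : ∀ l i j, W (E^[l] (algebraMap O[X] R X ^ i * ω j)) (i + w + w * l)

namespace StSetup

variable {O R G ι : Type*} [CommRing O] [CommRing R] [Algebra O R] [Algebra O[X] R]
    [IsScalarTower O O[X] R] [Group G] [Fintype G] [MulSemiringAction G R]

theorem injO (S : StSetup O R G ι) : Function.Injective (algebraMap O R) := by
  rw [IsScalarTower.algebraMap_eq O O[X] R]
  exact S.inj.comp (C_injective)

open Classical in
theorem wronskian_aux (S : StSetup O R G ι) [IsDomain O] [IsDomain R] {I : Type*} [Fintype I] (u : I → R)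
    (hu : LinearIndependent O u) (n : ℕ) : ∀ y : I → R,
    (Finset.univ.filter (fun i => y i ≠ 0)).card = n →
    (∀ l, ∑ i, S.E^[l] (u i) * y i = 0) → y = 0 := by
  classical
  induction n using Nat.strong_induction_on with
  | _ n ih =>
  intro y hyn hy
  by_contra hne
  obtain ⟨i1, hi1⟩ := Function.ne_iff.1 hne
  simp only [Pi.zero_apply] at hi1
  have hEy : ∀ l, ∑ i, S.E^[l] (u i) * S.E (y i) = 0 := by
    intro l
    have h1 := congrArg S.E (hy l)
    rw [map_sum, map_zero] at h1
    have h2 := hy (l + 1)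
    simp only [Function.iterate_succ_apply'] at h2
    have h3 : ∀ i, S.E (S.E^[l] (u i) * y i) =
        S.E^[l] (u i) * S.E (y i) + S.E (S.E^[l] (u i)) * y i := by
      intro i
      rw [S.E.leibniz, smul_eq_mul, smul_eq_mul, mul_comm (y i)]
    simp only [h3, Finset.sum_add_distrib, h2, add_zero] at h1
    exact h1
  let y' : I → R := fun i => y i1 * S.E (y i) - y i * S.E (y i1)
  have hy' : y' = 0 := by
    refine ih _ ?_ y' rfl ?_
    · rw [← hyn]
      apply Finset.card_lt_card
      rw [Finset.ssubset_iff_of_subset]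
      · exact ⟨i1, by simpa using hi1, by simp [y', mul_comm]⟩
      · intro i hi
        simp only [Finset.mem_filter, Finset.mem_univ, true_and] at hi ⊢
        intro h0
        apply hi
        simp [y', h0]
    · intro l
      have : ∀ i, S.E^[l] (u i) * y' i =
          y i1 * (S.E^[l] (u i) * S.E (y i)) - S.E (y i1) * (S.E^[l] (u i) * y i) := by
        intro i; simp only [y']; ring
      simp only [this, Finset.sum_sub_distrib, ← Finset.mul_sum, hy l, hEy l]
      simp
  have hc : ∀ i, ∃ a b : O, b ≠ 0 ∧ algebraMap O R b * y i = algebraMap O R a * y i1 := by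
    intro i
    apply S.const _ _ hi1
    have := congrFun hy' i
    simp only [y', Pi.zero_apply] at this
    exact (sub_eq_zero.1 this).symm
  choose a b hb hab using hc
  let a' : I → O := fun i => (∏ k ∈ Finset.univ.erase i, b k) * a i
  have hab' : ∀ i, algebraMap O R (∏ k, b k) * y i = algebraMap O R (a' i) * y i1 := by
    intro i
    simp only [a']
    rw [← Finset.mul_prod_erase _ _ (Finset.mem_univ i), map_mul, map_mul, mul_assoc, mul_assoc,
      ← hab i]
    ring
  have h0 : (∑ i, a' i • u i) * y i1 = 0 := by
    have h1 := hy 0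
    simp only [Function.iterate_zero, id_eq] at h1
    rw [Finset.sum_mul]
    have : ∀ i, a' i • u i * y i1 = algebraMap O R (∏ k, b k) * (u i * y i) := by
      intro i
      rw [Algebra.smul_def]
      have := hab' i
      linear_combination (-u i) * this
    simp only [this, ← Finset.mul_sum, h1, mul_zero]
  have h2 := (mul_eq_zero.1 h0).resolve_right hi1
  have h3 := Fintype.linearIndependent_iff.1 hu a' h2 i1
  have h4 := hab' i1
  rw [h3, map_zero, zero_mul] at h4
  rcases mul_eq_zero.1 h4 with h5 | h5
  · have h6 : (∏ k, b k) = 0 := S.injO (by rw [h5, map_zero])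
    obtain ⟨k, _, hk⟩ := Finset.prod_eq_zero_iff.1 h6
    exact hb k hk
  · exact hi1 h5

theorem wronskian (S : StSetup O R G ι) [IsDomain O] [IsDomain R] {I : Type*} [Fintype I] [DecidableEq I] (u : I → R)
    (hu : LinearIndependent O u) : ∃ γ : R, γ ≠ 0 ∧ ∀ i0 : I, ∃ (s : Finset ℕ) (b : ℕ → R),
      ∀ i, ∑ l ∈ s, b l * S.E^[l] (u i) = if i = i0 then γ else 0 := by
  have := fun i0 => st_leftinv (fun (l : ℕ) i => S.E^[l] (u i))
    (fun y hy => S.wronskian_aux u hu _ y rfl hy) i0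
  choose γ hγ s b hb using this
  refine ⟨∏ i, γ i, Finset.prod_ne_zero_iff.2 fun i _ => hγ i, fun i0 => ⟨s i0,
    fun l => (∏ k ∈ Finset.univ.erase i0, γ k) * b i0 l, fun i => ?_⟩⟩
  simp only [mul_assoc, ← Finset.mul_sum, hb]
  split_ifs with h
  · exact Finset.prod_erase_mul _ _ (Finset.mem_univ i0)
  · simp

theorem exists_norm (_ : StSetup O R G ι) [IsDomain R] [Algebra.IsInvariant O[X] R G] (y : R) (hy : y ≠ 0) :
    ∃ (P : O[X]) (z : R), P ≠ 0 ∧ algebraMap O[X] R P = y * z := by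
  classical
  obtain ⟨P, hP⟩ := Algebra.IsInvariant.isInvariant (A := O[X]) (G := G) (∏ τ : G, τ • y) (by
    intro g
    rw [Finset.smul_prod']
    simp only [← mul_smul]
    exact Fintype.prod_equiv (Equiv.mulLeft g) _ _ (fun x => rfl))
  refine ⟨P, ∏ τ ∈ Finset.univ.erase (1 : G), τ • y, ?_, ?_⟩
  · rintro rfl
    rw [map_zero] at hP
    obtain ⟨τ, _, hτ⟩ := Finset.prod_eq_zero_iff.1 hP.symm
    rw [smul_eq_zero_iff_eq] at hτ
    exact hy hτ
  · rw [hP, ← Finset.mul_prod_erase _ _ (Finset.mem_univ (1 : G)), one_smul]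

/-- Frobenius-type discriminant elements. -/
theorem exists_disc (S : StSetup O R G ι) [IsDomain R] [Fintype ι] [DecidableEq ι] [DecidableEq G] :
    ∃ γ : R, γ ≠ 0 ∧ ∃ b : ι → R, ∀ y : R, γ * y = ∑ j, b j * ∑ τ : G, τ • (S.ω j * y) := by
  obtain ⟨γ, hγ, s, b, hb⟩ := st_leftinv (fun (j : ι) (τ : G) => τ • S.ω j) S.ω_ded 1
  refine ⟨γ, hγ, fun j => if j ∈ s then b j else 0, fun y => ?_⟩
  have : ∀ j, (if j ∈ s then b j else 0) * ∑ τ : G, τ • (S.ω j * y) =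
      if j ∈ s then b j * ∑ τ : G, τ • (S.ω j * y) else 0 := by
    intro j; split_ifs <;> simp
  simp only [this, ← Finset.sum_filter]
  rw [Finset.filter_mem_eq_inter, Finset.univ_inter]
  simp only [Finset.mul_sum, smul_mul', ← mul_assoc]
  rw [Finset.sum_comm]
  simp only [← Finset.sum_mul, hb]
  simp

/-- primes above `p[X]` are stable under `E`. -/
theorem stable (S : StSetup O R G ι) [IsDomain R] [Fintype ι] [Algebra.IsInvariant O[X] R G] (γ : R) (b : ι → R)
    (hb : ∀ y : R, γ * y = ∑ j, b j * ∑ τ : G, τ • (S.ω j * y)) (p : Ideal O)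
    (P : Ideal R) [P.IsPrime] (hP : ∀ f : O[X], algebraMap O[X] R f ∈ P ↔
      f.map (Ideal.Quotient.mk p) = 0) (hγ : γ ∉ P) (h : R) (hh : h ∈ P) : S.E h ∈ P := by
  classical
  -- if `τ • P ⊆ P` then equality
  have key : ∀ τ : G, (∀ x ∈ P, τ • x ∈ P) → ∀ x, τ • x ∈ P → x ∈ P := by
    intro τ hτ x hx
    have h1 : ∀ n : ℕ, ∀ x ∈ P, τ ^ n • x ∈ P := by
      intro n
      induction n with
      | zero => intro x hx; simpa using hx
      | succ n ih => intro x hx; rw [pow_succ', mul_smul]; exact hτ _ (ih x hx)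
    have h2 := h1 (orderOf τ - 1) _ hx
    rw [← mul_smul, ← pow_succ, Nat.sub_add_cancel (orderOf_pos τ), pow_orderOf_eq_one,
      one_smul] at h2
    exact h2
  -- an element outside `P` in all the other conjugates
  have hs : ∀ τ : G, ∃ s : R, s ∉ P ∧ ((∀ x ∈ P, τ • x ∈ P) ∨ τ • s ∈ P) := by
    intro τ
    by_cases hτ : ∀ x ∈ P, τ • x ∈ P
    · exact ⟨1, fun h1 => Ideal.IsPrime.ne_top ‹_› (Ideal.eq_top_iff_one _ |>.2 h1), Or.inl hτ⟩
    · have : ¬ ∀ x ∈ P, τ⁻¹ • x ∈ P := by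
        intro h1
        apply hτ
        intro x hx
        refine key τ⁻¹ h1 _ ?_
        simpa using hx
      push Not at this
      obtain ⟨x, hx, hx'⟩ := this
      exact ⟨τ⁻¹ • x, hx', Or.inr (by simpa using hx)⟩
  choose s hs1 hs2 using hs
  let t := ∏ τ, s τ
  have ht : t ∉ P := by
    intro h1
    obtain ⟨τ, _, h2⟩ := Ideal.IsPrime.prod_mem_iff.1 h1
    exact hs1 τ h2
  have hth : ∀ τ : G, τ • (t * h) ∈ P := by
    intro τ
    rw [smul_mul']
    rcases hs2 τ with h1 | h1
    · exact P.mul_mem_left _ (h1 h hh)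
    · apply P.mul_mem_right
      simp only [t]
      rw [← Finset.mul_prod_erase _ _ (Finset.mem_univ τ), smul_mul']
      exact P.mul_mem_right _ h1
  -- traces are in `p[X]`
  have hEp : ∀ j, ∃ f : O[X], algebraMap O[X] R f = ∑ τ : G, τ • (S.ω j * (t * h)) ∧
      f.map (Ideal.Quotient.mk p) = 0 := by
    intro j
    obtain ⟨f, hf⟩ := Algebra.IsInvariant.isInvariant (A := O[X]) (G := G)
      (∑ τ : G, τ • (S.ω j * (t * h))) (by
        intro g
        rw [Finset.smul_sum]
        simp only [← mul_smul]
        exact Fintype.sum_equiv (Equiv.mulLeft g) _ _ (fun x => rfl))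
    refine ⟨f, hf, (hP f).1 ?_⟩
    rw [hf]
    apply P.sum_mem
    intro τ _
    rw [smul_mul']
    exact P.mul_mem_left _ (hth τ)
  choose f hf hfp using hEp
  have h1 : γ * (t * h) = ∑ j, b j * algebraMap O[X] R (f j) := by
    rw [hb]; simp only [hf]
  have hEf : ∀ f : O[X], f.map (Ideal.Quotient.mk p) = 0 → S.E (algebraMap O[X] R f) ∈ P := by
    intro f hf
    have h2 : algebraMap O[X] R f = aeval (algebraMap O[X] R X) f := by
      rw [aeval_algebraMap_apply, aeval_X_left_apply]
    rw [h2, Derivation.map_aeval, smul_eq_mul]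
    apply P.mul_mem_right
    rw [aeval_algebraMap_apply, aeval_X_left_apply, hP, ← derivative_map, hf, derivative_zero]
  have h3 := congrArg S.E h1
  rw [map_sum, S.E.leibniz, smul_eq_mul, smul_eq_mul, S.E.leibniz, smul_eq_mul, smul_eq_mul] at h3
  have h4 : ∑ j, S.E (b j * algebraMap O[X] R (f j)) ∈ P := by
    apply P.sum_mem
    intro j _
    rw [S.E.leibniz, smul_eq_mul, smul_eq_mul]
    exact P.add_mem (P.mul_mem_left _ (hEf _ (hfp j)))
      (P.mul_mem_right _ ((hP _).2 (hfp j)))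
  rw [← h3] at h4
  have h5 : γ * t * S.E h ∈ P := by
    have h6 : γ * t * S.E h = (γ * (t * S.E h + h * S.E t) + t * h * S.E γ) -
        h * (γ * S.E t + t * S.E γ) := by ring
    rw [h6]
    exact P.sub_mem h4 (P.mul_mem_right _ hh)
  rcases Ideal.IsPrime.mem_or_mem ‹_› h5 with h6 | h6
  · rcases Ideal.IsPrime.mem_or_mem ‹_› h6 with h7 | h7
    · exact absurd h7 hγ
    · exact absurd h7 ht
  · exact h6

end StSetup

namespace StSetup

variable {O R G ι : Type*} [CommRing O] [CommRing R] [Algebra O R] [Algebra O[X] R]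
    [IsScalarTower O O[X] R] [Group G] [Fintype G] [MulSemiringAction G R]

/-- The auxiliary functions `X ^ i * ω j`. -/
noncomputable def u (S : StSetup O R G ι) (n : ℕ) (i : Fin n × ι) : R :=
  algebraMap O[X] R X ^ (i.1 : ℕ) * S.ω i.2

theorem u_ind (S : StSetup O R G ι) [Fintype ι] (n : ℕ) : LinearIndependent O (S.u n) := by
  classical
  rw [Fintype.linearIndependent_iff]
  intro g hg
  have h1 : ∑ j, (∑ i : Fin n, C (g (i, j)) * X ^ (i : ℕ) : O[X]) • S.ω j = 0 := by
    rw [← hg, Fintype.sum_prod_type_right]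
    refine Finset.sum_congr rfl fun j _ => ?_
    rw [Finset.sum_smul]
    refine Finset.sum_congr rfl fun i _ => ?_
    rw [u, Algebra.smul_def, Algebra.smul_def, map_mul, map_pow, mul_assoc,
      IsScalarTower.algebraMap_apply O O[X] R]
    rfl
  have h2 := Fintype.linearIndependent_iff.1 S.ω_ind _ h1
  rintro ⟨i, j⟩
  have h3 := congrArg (fun f => coeff f (i : ℕ)) (h2 j)
  simp only [finsetSum_coeff, coeff_C_mul, coeff_X_pow, coeff_zero] at h3
  rw [Finset.sum_eq_single i] at h3
  · simpa using h3
  · intro b _ hb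
    have : (i : ℕ) ≠ b := fun h => hb (Fin.ext h.symm)
    simp [this]
  · simp

theorem W_zero (S : StSetup O R G ι) (n : ℕ) : S.W 0 n := by
  have := S.W_const 0
  rw [map_zero] at this
  exact S.W_mono _ _ _ (Nat.zero_le _) this

theorem W_one (S : StSetup O R G ι) (n : ℕ) : S.W 1 n := by
  have := S.W_const 1
  rw [map_one] at this
  exact S.W_mono _ _ _ (Nat.zero_le _) this

theorem W_sum (S : StSetup O R G ι) {α : Type*} (s : Finset α) (f : α → R) (n : ℕ)
    (h : ∀ a ∈ s, S.W (f a) n) : S.W (∑ a ∈ s, f a) n :=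
  Finset.sum_induction f (fun x => S.W x n) (fun x y => S.W_add x y n) (S.W_zero n) h

theorem W_prod (S : StSetup O R G ι) {α : Type*} (s : Finset α) (f : α → R) (n : ℕ)
    (h : ∀ a ∈ s, S.W (f a) n) : S.W (∏ a ∈ s, f a) (s.card * n) := by
  classical
  induction s using Finset.induction_on with
  | empty => simpa using S.W_one 0
  | insert a s ha ih =>
    rw [Finset.prod_insert ha, Finset.card_insert_of_notMem ha]
    have := S.W_mul _ _ _ _ (h a (by simp)) (ih fun i hi => h i (by simp [hi]))
    refine S.W_mono _ _ _ (le_of_eq ?_) this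
    ring

theorem W_pow (S : StSetup O R G ι) (x : R) (n q : ℕ) (h : S.W x n) : S.W (x ^ q) (q * n) := by
  have := S.W_prod (Finset.range q) (fun _ => x) n (fun _ _ => h)
  simpa using this

theorem W_u (S : StSetup O R G ι) (n l : ℕ) (i : Fin n × ι) :
    S.W (S.E^[l] (S.u n i)) (n + S.w + S.w * l) :=
  S.W_mono _ _ _ (by have := i.1.2; omega) (S.W_E l i.1 i.2)

/-- existence of the coefficients of the auxiliary function. -/
theorem exists_coeff (S : StSetup O R G ι) [IsDomain O] [IsDomain R] [Fintype ι]
    [Algebra.IsInvariant O[X] R G] [SMulCommClass G O[X] R] (σ : G) (m n k : ℕ)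
    (h : m * (Fintype.card ι * (n + k + S.w * m + 3 * S.w + 1)) <
      (n * Fintype.card ι) * (k * Fintype.card ι)) :
    ∃ c : (Fin n × ι) × (Fin k × ι) → O, c ≠ 0 ∧ ∀ l < m,
      ∑ x, algebraMap O R (c x) * (S.E^[l] (S.u n x.1) * σ • S.u k x.2) = 0 := by
  classical
  obtain ⟨γ, hγ, b, hb⟩ := S.exists_disc
  have hT : ∀ (l : Fin m) (j : ι) (x : (Fin n × ι) × (Fin k × ι)), ∃ f : O[X],
      algebraMap O[X] R f = ∑ τ : G, τ • (S.ω j * (S.E^[l] (S.u n x.1) * σ • S.u k x.2)) ∧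
      f.natDegree < n + k + S.w * m + 3 * S.w + 1 := by
    intro l j x
    obtain ⟨f, hf⟩ := Algebra.IsInvariant.isInvariant (A := O[X]) (G := G)
      (∑ τ : G, τ • (S.ω j * (S.E^[l] (S.u n x.1) * σ • S.u k x.2))) (by
        intro g
        rw [Finset.smul_sum]
        simp only [← mul_smul]
        exact Fintype.sum_equiv (Equiv.mulLeft g) _ _ (fun x => rfl))
    refine ⟨f, hf, Nat.lt_succ_of_le ?_⟩
    apply S.W_deg
    rw [hf]
    apply S.W_sum
    intro τ _
    apply S.W_G
    have h1 : S.W (S.ω j) S.w := by simpa using S.W_E 0 0 j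
    have h2 := S.W_u n l x.1
    have h3 : S.W (S.u k x.2) (k + S.w) := by simpa using S.W_u k 0 x.2
    refine S.W_mono _ _ _ ?_ (S.W_mul _ _ _ _ h1 (S.W_mul _ _ _ _ h2 (S.W_G σ _ _ h3)))
    have : S.w * l ≤ S.w * m := Nat.mul_le_mul_left _ l.2.le
    omega
  choose T hT1 hT2 using hT
  let N := n + k + S.w * m + 3 * S.w + 1
  let Φ : ((Fin n × ι) × (Fin k × ι) → O) →ₗ[O] (Fin m × ι × Fin N → O) :=
    { toFun := fun c y => ∑ x, c x * (T y.1 y.2.1 x).coeff y.2.2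
      map_add' := by
        intro c d; ext y
        simp [add_mul, Finset.sum_add_distrib]
      map_smul' := by
        intro c d; ext y
        simp [Finset.mul_sum, mul_assoc] }
  have hni : ¬ Function.Injective Φ := by
    intro hi
    have := LinearMap.finrank_le_finrank_of_injective hi
    simp only [Module.finrank_fintype_fun_eq_card, Fintype.card_prod, Fintype.card_fin] at this
    exact absurd this (not_le.2 h)
  rw [← LinearMap.ker_eq_bot, Submodule.eq_bot_iff] at hni
  push Not at hni
  obtain ⟨c, hc, hc0⟩ := hni
  refine ⟨c, hc0, fun l hl => ?_⟩
  set y := ∑ x, algebraMap O R (c x) * (S.E^[l] (S.u n x.1) * σ • S.u k x.2) with hy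
  have htr : ∀ j, ∑ τ : G, τ • (S.ω j * y) = 0 := by
    intro j
    have h1 : (∑ x, C (c x) * T ⟨l, hl⟩ j x) = 0 := by
      ext d
      rw [finsetSum_coeff, coeff_zero]
      simp only [coeff_C_mul]
      by_cases hd : d < N
      · exact congrFun hc (⟨l, hl⟩, j, ⟨d, hd⟩)
      · apply Finset.sum_eq_zero
        intro x _
        rw [coeff_eq_zero_of_natDegree_lt, mul_zero]
        exact lt_of_lt_of_le (hT2 _ _ _) (not_lt.1 hd)
    have h2 := congrArg (algebraMap O[X] R) h1
    simp only [map_sum, map_zero, map_mul, hT1] at h2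
    rw [← h2]
    simp only [hy, Finset.mul_sum, Finset.smul_sum]
    rw [Finset.sum_comm]
    refine Finset.sum_congr rfl fun x _ => Finset.sum_congr rfl fun τ _ => ?_
    have h3 : algebraMap O[X] R (C (c x)) = algebraMap O R (c x) :=
      (IsScalarTower.algebraMap_apply O O[X] R (c x)).symm
    rw [h3, mul_left_comm, smul_mul']
    congr 1
    -- constants are fixed
    rw [← h3]
    exact smul_algebraMap τ _
  have h4 := hb y
  simp only [htr, mul_zero, Finset.sum_const_zero] at h4
  exact (mul_eq_zero.1 h4).resolve_left hγ

end StSetup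

namespace StSetup

variable {O R G ι : Type*} [CommRing O] [CommRing R] [Algebra O R] [Algebra O[X] R]
    [IsScalarTower O O[X] R] [Group G] [Fintype G] [MulSemiringAction G R]

theorem iter_mul_pow (S : StSetup O R G ι) (l q : ℕ) (x v : R) :
    ∃ z, S.E^[l] (x * v ^ q) = S.E^[l] x * v ^ q + (q : R) * z := by
  induction l with
  | zero => exact ⟨0, by simp⟩
  | succ l ih =>
    obtain ⟨z, hz⟩ := ih
    refine ⟨S.E^[l] x * v ^ (q - 1) * S.E v + S.E z, ?_⟩
    rw [Function.iterate_succ_apply', hz, map_add, S.E.leibniz, S.E.leibniz_pow, S.E.leibniz,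
      S.E.map_natCast, Function.iterate_succ_apply']
    simp only [smul_eq_mul, nsmul_eq_mul, mul_zero, add_zero]
    ring

theorem iter_sum (S : StSetup O R G ι) {X : Type*} [Fintype X] (l : ℕ) (c : X → O) (g : X → R) :
    S.E^[l] (∑ x, algebraMap O R (c x) * g x) = ∑ x, algebraMap O R (c x) * S.E^[l] (g x) := by
  have h : ∀ y, S.E^[l] y = ((S.E : R →ₗ[O] R) ^ l) y := by
    intro y; rw [Module.End.pow_apply]; rfl
  simp only [h, ← Algebra.smul_def, map_sum, map_smul]

theorem iter_G (S : StSetup O R G ι) (τ : G) (l : ℕ) (x : R) :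
    S.E^[l] (τ • x) = τ • S.E^[l] x := by
  induction l with
  | zero => rfl
  | succ l ih => rw [Function.iterate_succ_apply', Function.iterate_succ_apply', ih, S.E_G]

theorem iter_alg (S : StSetup O R G ι) (l : ℕ) (P : O[X]) :
    S.E^[l] (algebraMap O[X] R P) =
      algebraMap O[X] R ((fun P => S.e * derivative P)^[l] P) := by
  have h : ∀ P : O[X], S.E (algebraMap O[X] R P) = algebraMap O[X] R (S.e * derivative P) := by
    intro P
    have h1 : ∀ P : O[X], algebraMap O[X] R P = aeval (algebraMap O[X] R X) P := by
      intro P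
      rw [aeval_algebraMap_apply, aeval_X_left_apply]
    rw [h1 P, S.E.map_aeval, S.E_X, map_mul, ← h1, smul_eq_mul, mul_comm]
  induction l with
  | zero => rfl
  | succ l ih => rw [Function.iterate_succ_apply', ih, h, Function.iterate_succ_apply']

/-- the auxiliary function -/
noncomputable def H (S : StSetup O R G ι) [Fintype ι] (n k q : ℕ)
    (c : (Fin n × ι) × (Fin k × ι) → O) : R :=
  ∑ x, algebraMap O R (c x) * (S.u n x.1 * S.u k x.2 ^ q)

theorem iter_H (S : StSetup O R G ι) [Fintype ι] (n k q : ℕ)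
    (c : (Fin n × ι) × (Fin k × ι) → O) (l : ℕ) :
    ∃ z, S.E^[l] (S.H n k q c) =
      ∑ x, algebraMap O R (c x) * (S.E^[l] (S.u n x.1) * S.u k x.2 ^ q) + (q : R) * z := by
  choose z hz using fun x : (Fin n × ι) × (Fin k × ι) =>
    S.iter_mul_pow l q (S.u n x.1) (S.u k x.2)
  refine ⟨∑ x, algebraMap O R (c x) * z x, ?_⟩
  rw [H, iter_sum, Finset.mul_sum, ← Finset.sum_add_distrib]
  refine Finset.sum_congr rfl fun x _ => ?_
  rw [hz]; ring

theorem cast_mem (_  : StSetup O R G ι) (p : Ideal O) (P : Ideal R)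
    (hP : ∀ f : O[X], f.map (Ideal.Quotient.mk p) = 0 → algebraMap O[X] R f ∈ P)
    (q : ℕ) (hq : (q : O) ∈ p) : (q : R) ∈ P := by
  have := hP (C (q : O)) (by rw [map_C, Ideal.Quotient.eq_zero_iff_mem.2 hq, C_0])
  simpa using this

theorem extract (S : StSetup O R G ι) {I : Type*} [Fintype I] [DecidableEq I] (u : I → R)
    (γ : R) (hγ : ∀ i0 : I, ∃ (s : Finset ℕ) (b : ℕ → R),
      ∀ i, ∑ l ∈ s, b l * S.E^[l] (u i) = if i = i0 then γ else 0)
    (P : Ideal R) [P.IsPrime] (hγP : γ ∉ P) (y : I → R)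
    (h : ∀ l, ∑ i, S.E^[l] (u i) * y i ∈ P) (i0 : I) : y i0 ∈ P := by
  obtain ⟨s, b, hb⟩ := hγ i0
  have h1 : ∑ l ∈ s, b l * ∑ i, S.E^[l] (u i) * y i ∈ P :=
    P.sum_mem fun l _ => P.mul_mem_left _ (h l)
  simp only [Finset.mul_sum, ← mul_assoc] at h1
  rw [Finset.sum_comm] at h1
  simp only [← Finset.sum_mul, hb, ite_mul, zero_mul, Finset.sum_ite_eq', Finset.mem_univ,
    if_true] at h1
  exact (Ideal.IsPrime.mem_or_mem ‹_› h1).resolve_left hγP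

theorem iter_mem (S : StSetup O R G ι) (P : Ideal R) (hE : ∀ x ∈ P, S.E x ∈ P) (l : ℕ) (x : R)
    (hx : x ∈ P) : S.E^[l] x ∈ P := by
  induction l with
  | zero => exact hx
  | succ l ih => rw [Function.iterate_succ_apply']; exact hE _ ih

/-- powers of linear combinations modulo a prime above `p`. -/
theorem sum_pow_mem (_ : StSetup O R G ι) (p : Ideal O) [p.IsMaximal] [Finite (O ⧸ p)]
    (P : Ideal R) [P.IsPrime] (hpP : ∀ c ∈ p, algebraMap O R c ∈ P) {J : Type*} [Fintype J]
    (c : J → O) (v : J → R)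
    (h : ∑ j, algebraMap O R (c j) * v j ^ Nat.card (O ⧸ p) ∈ P) :
    ∑ j, algebraMap O R (c j) * v j ∈ P := by
  let _ := Ideal.Quotient.field p
  have := Fintype.ofFinite (O ⧸ p)
  obtain ⟨p0, hchar⟩ := CharP.exists (O ⧸ p)
  obtain ⟨f, hp0, hf⟩ := FiniteField.card (O ⧸ p) p0
  rw [Nat.card_eq_fintype_card] at h
  have := Fact.mk hp0
  have hcast : ((p0 : ℕ) : R ⧸ P) = 0 := by
    have h1 : ((p0 : ℕ) : O) ∈ p := by
      rw [← Ideal.Quotient.eq_zero_iff_mem]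
      simp [CharP.cast_eq_zero]
    have h2 := hpP _ h1
    rw [← Ideal.Quotient.eq_zero_iff_mem] at h2
    simpa using h2
  have : CharP (R ⧸ P) p0 := by
    obtain ⟨r, hr⟩ := CharP.exists (R ⧸ P)
    have h3 : r ∣ p0 := (CharP.cast_eq_zero_iff (R ⧸ P) r p0).1 hcast
    rcases (Nat.dvd_prime hp0).1 h3 with h4 | h4
    · subst h4
      exact (CharP.char_ne_one (R ⧸ P) 1 rfl).elim
    · rwa [h4] at hr
  have hc : ∀ j, algebraMap O R (c j) ^ Fintype.card (O ⧸ p) - algebraMap O R (c j) ∈ P := by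
    intro j
    rw [← map_pow, ← map_sub]
    apply hpP
    rw [← Ideal.Quotient.eq_zero_iff_mem, map_sub, map_pow, FiniteField.pow_card, sub_self]
  rw [← Ideal.Quotient.eq_zero_iff_mem] at h ⊢
  have key : (Ideal.Quotient.mk P (∑ j, algebraMap O R (c j) * v j)) ^ Fintype.card (O ⧸ p) = 0 := by
    rw [← h, hf, map_sum, sum_pow_char_pow, map_sum]
    refine Finset.sum_congr rfl fun j _ => ?_
    have h5 := hc j
    rw [← Ideal.Quotient.eq_zero_iff_mem, map_sub, map_pow, sub_eq_zero, hf] at h5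
    rw [map_mul, mul_pow, h5, map_mul, map_pow]
  exact pow_eq_zero_iff (Fintype.card_ne_zero) |>.1 key

theorem nonvanish (S : StSetup O R G ι) [Fintype ι] [DecidableEq ι]
    (p : Ideal O) [p.IsMaximal] [Finite (O ⧸ p)]
    (P : Ideal R) [P.IsPrime]
    (hP : ∀ f : O[X], algebraMap O[X] R f ∈ P ↔ f.map (Ideal.Quotient.mk p) = 0)
    (hE : ∀ x ∈ P, S.E x ∈ P) (n k : ℕ) (c : (Fin n × ι) × (Fin k × ι) → O)
    (γu γv : R) (hγu : γu ∉ P) (hγv : γv ∉ P)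
    (hu : ∀ i0, ∃ (s : Finset ℕ) (b : ℕ → R),
      ∀ i, ∑ l ∈ s, b l * S.E^[l] (S.u n i) = if i = i0 then γu else 0)
    (hv : ∀ i0, ∃ (s : Finset ℕ) (b : ℕ → R),
      ∀ i, ∑ l ∈ s, b l * S.E^[l] (S.u k i) = if i = i0 then γv else 0)
    (x0 : (Fin n × ι) × (Fin k × ι)) (hx0 : c x0 ∉ p) :
    S.H n k (Nat.card (O ⧸ p)) c ∉ P := by
  intro hH
  have hpP : ∀ c ∈ p, algebraMap O R c ∈ P := by
    intro c hc
    have := (hP (C c)).2 (by rw [map_C, Ideal.Quotient.eq_zero_iff_mem.2 hc, C_0])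
    rwa [IsScalarTower.algebraMap_apply O O[X] R]
  have hqp : ((Nat.card (O ⧸ p) : ℕ) : O) ∈ p := by
    rw [← Ideal.Quotient.eq_zero_iff_mem, map_natCast]
    have := Fintype.ofFinite (O ⧸ p)
    rw [Nat.card_eq_fintype_card]
    exact Nat.cast_card_eq_zero (O ⧸ p)
  have hq : ((Nat.card (O ⧸ p) : ℕ) : R) ∈ P := by
    have := hpP _ hqp
    simpa using this
  have h1 : ∑ j, algebraMap O R (c (x0.1, j)) * S.u k j ^ Nat.card (O ⧸ p) ∈ P := by
    refine S.extract (S.u n) γu hu P hγu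
      (fun i => ∑ j, algebraMap O R (c (i, j)) * S.u k j ^ Nat.card (O ⧸ p)) (fun l => ?_) x0.1
    obtain ⟨z, hz⟩ := S.iter_H n k (Nat.card (O ⧸ p)) c l
    have h2 := S.iter_mem P hE l _ hH
    rw [hz] at h2
    have h3 := (Ideal.add_mem_iff_left P (P.mul_mem_right z hq)).1 h2
    rw [Fintype.sum_prod_type] at h3
    convert h3 using 2 with i
    rw [Finset.mul_sum]
    refine Finset.sum_congr rfl fun j _ => ?_
    ring
  have h2 := S.sum_pow_mem p P hpP _ _ h1
  have h3 : algebraMap O R (c (x0.1, x0.2)) ∈ P := by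
    refine S.extract (S.u k) γv hv P hγv (fun j => algebraMap O R (c (x0.1, j)))
      (fun l => ?_) x0.2
    have h4 := S.iter_mem P hE l _ h2
    rw [iter_sum] at h4
    simpa only [mul_comm] using h4
  apply hx0
  rw [IsScalarTower.algebraMap_apply O O[X] R] at h3
  have := (hP _).1 h3
  rw [Polynomial.algebraMap_apply, Algebra.algebraMap_self, RingHom.id_apply, map_C, C_eq_zero] at this
  exact Ideal.Quotient.eq_zero_iff_mem.1 this

theorem vanish (S : StSetup O R G ι) [Fintype ι] [SMulCommClass G O[X] R] (q : ℕ)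
    (Q : Ideal R) (hq : (q : R) ∈ Q) (n k m : ℕ) (c : (Fin n × ι) × (Fin k × ι) → O)
    (σ σa τ : G) (hσ : τ⁻¹ * σa * τ = σ)
    (hc : ∀ l < m,
      ∑ x, algebraMap O R (c x) * (S.E^[l] (S.u n x.1) * σ • S.u k x.2) = 0)
    (hFrob : ∀ x : R, σa • x - x ^ q ∈ Q) :
    StVan S.E Q m (τ • S.H n k q c) := by
  intro l hl
  obtain ⟨z, hz⟩ := S.iter_H n k q c l
  have hfix : ∀ c : O, τ • algebraMap O R c = algebraMap O R c := by
    intro c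
    rw [IsScalarTower.algebraMap_apply O O[X] R]
    exact smul_algebraMap τ _
  rw [S.iter_G, hz, smul_add, smul_mul', Finset.smul_sum]
  refine Q.add_mem ?_ (Q.mul_mem_right _ ?_)
  · have h0 := congrArg (fun y => τ • y) (hc l hl)
    simp only [smul_zero, Finset.smul_sum] at h0
    rw [← sub_zero (∑ x, _), ← h0, ← Finset.sum_sub_distrib]
    refine Q.sum_mem fun x _ => ?_
    have h1 := hFrob (τ • S.u k x.2)
    have h2 : τ • σ • S.u k x.2 = σa • τ • S.u k x.2 := by
      rw [← mul_smul, ← mul_smul, ← hσ]; congr 1; group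
    simp only [smul_mul', hfix, smul_pow', h2, ← mul_sub]
    refine Q.mul_mem_left _ (Q.mul_mem_left _ ?_)
    rw [← neg_sub]
    exact Q.neg_mem h1
  · have : τ • (q : R) = (q : R) := map_natCast (MulSemiringAction.toRingHom G R τ) q
    rwa [this]

end StSetup

namespace StSetup

variable {O R G ι : Type*} [CommRing O] [CommRing R] [Algebra O R] [Algebra O[X] R]
    [IsScalarTower O O[X] R] [Group G] [Fintype G] [MulSemiringAction G R]

theorem H_weight (S : StSetup O R G ι) [Fintype ι] (n k q : ℕ)
    (c : (Fin n × ι) × (Fin k × ι) → O) : S.W (S.H n k q c) ((n + S.w) + q * (k + S.w)) := by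
  apply S.W_sum
  intro x _
  have h2 : S.W (S.u n x.1) (n + S.w) := by simpa using S.W_u n 0 x.1
  have h3 : S.W (S.u k x.2) (k + S.w) := by simpa using S.W_u k 0 x.2
  have := S.W_mul _ _ _ _ (S.W_const (c x)) (S.W_mul _ _ _ _ h2 (S.W_pow _ _ q h3))
  simpa using this

theorem H_norm (S : StSetup O R G ι) [Fintype ι] [Algebra.IsInvariant O[X] R G] (n k q : ℕ)
    (c : (Fin n × ι) × (Fin k × ι) → O) :
    ∃ P : O[X], algebraMap O[X] R P = ∏ τ : G, τ • S.H n k q c ∧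
      P.natDegree ≤ Fintype.card G * ((n + S.w) + q * (k + S.w)) := by
  obtain ⟨P, hP⟩ := Algebra.IsInvariant.isInvariant (A := O[X]) (G := G)
    (∏ τ : G, τ • S.H n k q c) (by
    intro g
    rw [Finset.smul_prod']
    simp only [← mul_smul]
    exact Fintype.prod_equiv (Equiv.mulLeft g) _ _ (fun x => rfl))
  refine ⟨P, hP, S.W_deg _ _ ?_⟩
  rw [hP]
  exact S.W_prod _ _ _ fun τ _ => S.W_G _ _ _ (S.H_weight n k q c)

theorem dvd_P (S : StSetup O R G ι) [Fintype ι] [DecidableEq G] [SMulCommClass G O[X] R]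
    (p : Ideal O) [p.IsMaximal] [Finite (O ⧸ p)] (a : O ⧸ p)
    (Q : Ideal R)
    (hQ : ∀ f : O[X], algebraMap O[X] R f ∈ Q ↔ (f.map (Ideal.Quotient.mk p)).eval a = 0)
    (n k m : ℕ) (c : (Fin n × ι) × (Fin k × ι) → O)
    (σ σa : G)
    (hc : ∀ l < m,
      ∑ x, algebraMap O R (c x) * (S.E^[l] (S.u n x.1) * σ • S.u k x.2) = 0)
    (hFrob : ∀ x : R, σa • x - x ^ Nat.card (O ⧸ p) ∈ Q)
    (he : (S.e.map (Ideal.Quotient.mk p)).eval a ≠ 0)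
    (hfac : ((m * Fintype.card G).factorial : O) ∉ p)
    (P : O[X]) (hP : algebraMap O[X] R P = ∏ τ : G, τ • S.H n k (Nat.card (O ⧸ p)) c) :
    (X - C a) ^ (m * (Finset.univ.filter fun τ : G => τ⁻¹ * σa * τ = σ).card) ∣
      P.map (Ideal.Quotient.mk p) := by
  let _ := Ideal.Quotient.field p
  have hqp : ((Nat.card (O ⧸ p) : ℕ) : O) ∈ p := by
    rw [← Ideal.Quotient.eq_zero_iff_mem, map_natCast]
    have := Fintype.ofFinite (O ⧸ p)
    rw [Nat.card_eq_fintype_card]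
    exact Nat.cast_card_eq_zero (O ⧸ p)
  have hq : ((Nat.card (O ⧸ p) : ℕ) : R) ∈ Q :=
    S.cast_mem p Q (fun f hf => (hQ f).2 (by rw [hf, eval_zero])) _ hqp
  have hv : StVan S.E Q (m * (Finset.univ.filter fun τ : G => τ⁻¹ * σa * τ = σ).card)
      (algebraMap O[X] R P) := by
    rw [hP]
    have := StVan.prod (E := S.E) (Q := Q) Finset.univ
      (fun τ : G => if τ⁻¹ * σa * τ = σ then m else 0)
      (fun τ => τ • S.H n k (Nat.card (O ⧸ p)) c) (by
        intro τ _
        split_ifs with h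
        · exact S.vanish _ Q hq n k m c σ σa τ h hc hFrob
        · intro l hl; omega)
    rwa [← Finset.sum_filter, Finset.sum_const, smul_eq_mul, mul_comm] at this
  refine st_mult (S.e.map (Ideal.Quotient.mk p)) a he _ ?_ _ ?_
  · intro h0
    apply hfac
    rw [← Ideal.Quotient.eq_zero_iff_mem, map_natCast]
    obtain ⟨d, hd⟩ := Nat.factorial_dvd_factorial (show
      m * (Finset.univ.filter fun τ : G => τ⁻¹ * σa * τ = σ).card ≤ m * Fintype.card G from
        Nat.mul_le_mul_left _ (Finset.card_le_univ _))
    rw [hd, Nat.cast_mul, h0, zero_mul]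
  · intro l hl
    have h1 := hv l hl
    rw [S.iter_alg, hQ] at h1
    have h2 : ∀ l, ((fun P => S.e * derivative P)^[l] P).map (Ideal.Quotient.mk p) =
        (fun P => S.e.map (Ideal.Quotient.mk p) * derivative P)^[l]
          (P.map (Ideal.Quotient.mk p)) := by
      intro l
      induction l with
      | zero => rfl
      | succ l ih =>
        rw [Function.iterate_succ_apply', Function.iterate_succ_apply', ← ih,
          Polynomial.map_mul, derivative_map]
    rw [← h2]
    exact h1

theorem P_ne (S : StSetup O R G ι) [IsDomain R] [Fintype ι] [DecidableEq ι]
    [Algebra.IsInvariant O[X] R G] [SMulCommClass G O[X] R]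
    (p : Ideal O) [p.IsMaximal] [Finite (O ⧸ p)]
    (n k : ℕ) (c : (Fin n × ι) × (Fin k × ι) → O)
    (γd γu γv : R) (Pd Pu Pv : O[X]) (zd zu zv : R)
    (hPd : algebraMap O[X] R Pd = γd * zd) (hPu : algebraMap O[X] R Pu = γu * zu)
    (hPv : algebraMap O[X] R Pv = γv * zv)
    (hPd0 : Pd.map (Ideal.Quotient.mk p) ≠ 0) (hPu0 : Pu.map (Ideal.Quotient.mk p) ≠ 0)
    (hPv0 : Pv.map (Ideal.Quotient.mk p) ≠ 0)
    (b : ι → R) (hb : ∀ y : R, γd * y = ∑ j, b j * ∑ τ : G, τ • (S.ω j * y))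
    (hu : ∀ i0, ∃ (s : Finset ℕ) (b : ℕ → R),
      ∀ i, ∑ l ∈ s, b l * S.E^[l] (S.u n i) = if i = i0 then γu else 0)
    (hv : ∀ i0, ∃ (s : Finset ℕ) (b : ℕ → R),
      ∀ i, ∑ l ∈ s, b l * S.E^[l] (S.u k i) = if i = i0 then γv else 0)
    (x0 : (Fin n × ι) × (Fin k × ι)) (hx0 : c x0 ∉ p)
    (P : O[X]) (hP : algebraMap O[X] R P = ∏ τ : G, τ • S.H n k (Nat.card (O ⧸ p)) c) :
    P.map (Ideal.Quotient.mk p) ≠ 0 := by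
  have hIntegral := Algebra.IsInvariant.isIntegral O[X] R G
  have hprime : (RingHom.ker (mapRingHom (Ideal.Quotient.mk p))).IsPrime :=
    RingHom.ker_isPrime _
  obtain ⟨𝔓, h𝔓, hcomap⟩ := Ideal.exists_ideal_over_prime_of_isIntegral_of_isDomain (S := R)
    (RingHom.ker (mapRingHom (Ideal.Quotient.mk p))) (by
      rw [(RingHom.injective_iff_ker_eq_bot _).1 S.inj]; exact bot_le)
  have hmem : ∀ f : O[X], algebraMap O[X] R f ∈ 𝔓 ↔ f.map (Ideal.Quotient.mk p) = 0 := by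
    intro f
    rw [← Ideal.mem_comap, hcomap, RingHom.mem_ker, coe_mapRingHom]
  intro h0
  have h1 := (hmem P).2 h0
  rw [hP, Ideal.IsPrime.prod_mem_iff] at h1
  obtain ⟨τ, _, hτ⟩ := h1
  let 𝔓' := 𝔓.comap (MulSemiringAction.toRingHom G R τ)
  have h𝔓' : 𝔓'.IsPrime := Ideal.IsPrime.comap _
  have hmem' : ∀ f : O[X], algebraMap O[X] R f ∈ 𝔓' ↔ f.map (Ideal.Quotient.mk p) = 0 := by
    intro f
    rw [← hmem f, Ideal.mem_comap]
    have : (MulSemiringAction.toRingHom G R τ) (algebraMap O[X] R f) = algebraMap O[X] R f :=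
      smul_algebraMap τ f
    rw [this]
  have hne : ∀ (B : O[X]) (γ z : R), algebraMap O[X] R B = γ * z →
      B.map (Ideal.Quotient.mk p) ≠ 0 → γ ∉ 𝔓' := by
    intro B γ z h hB hγ
    apply hB
    rw [← hmem' B, h]
    exact Ideal.mul_mem_right _ _ hγ
  refine S.nonvanish p 𝔓' hmem' (fun x hx => ?_) n k c γu γv (hne _ _ _ hPu hPu0)
    (hne _ _ _ hPv hPv0) hu hv x0 hx0 hτ
  exact S.stable γd b hb p 𝔓' hmem' (hne _ _ _ hPd hPd0) x hx

theorem stepanov (S : StSetup O R G ι) [IsDomain O] [CharZero O] [IsDomain R] [Fintype ι]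
    [DecidableEq G]
    [Algebra.IsInvariant O[X] R G] [SMulCommClass G O[X] R]
    (hcard : Fintype.card ι = Fintype.card G) (σ : G) (k : ℕ) :
    ∃ β : O[X], β ≠ 0 ∧ ∃ N : ℕ, ∀ (p : Ideal O) [p.IsMaximal] [Finite (O ⧸ p)],
      β.map (Ideal.Quotient.mk p) ≠ 0 →
      ∀ (s : Finset (O ⧸ p)) (Q : O ⧸ p → Ideal R) (σa : O ⧸ p → G),
      (∀ a ∈ s, (∀ f : O[X], algebraMap O[X] R f ∈ Q a ↔
          (f.map (Ideal.Quotient.mk p)).eval a = 0) ∧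
        (∀ x : R, σa a • x - x ^ Nat.card (O ⧸ p) ∈ Q a) ∧
        (β.map (Ideal.Quotient.mk p)).eval a ≠ 0) →
      k * ∑ a ∈ s, (Finset.univ.filter fun τ : G => τ⁻¹ * σa a * τ = σ).card ≤
        N + Nat.card (O ⧸ p) * (k + 1 + S.w) := by
  classical
  set r := Fintype.card G with hr
  have hr0 : 0 < r := Fintype.card_pos
  let n := k * ((k + 1) + S.w * (r * k) + 3 * S.w + 1) + 1
  obtain ⟨c, hc0, hc⟩ := S.exists_coeff σ (r * k) n (k + 1) (by
    rw [hcard]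
    have h1 : k * (n + (k + 1) + S.w * (r * k) + 3 * S.w + 1) < n * (k + 1) := by
      have : n * (k + 1) = k * n + n := by ring
      rw [this]
      have : k * (n + (k + 1) + S.w * (r * k) + 3 * S.w + 1) =
        k * n + k * ((k + 1) + S.w * (r * k) + 3 * S.w + 1) := by ring
      rw [this]
      omega
    calc r * k * (r * (n + (k + 1) + S.w * (r * k) + 3 * S.w + 1))
        = (r * r) * (k * (n + (k + 1) + S.w * (r * k) + 3 * S.w + 1)) := by ring
      _ < (r * r) * (n * (k + 1)) := Nat.mul_lt_mul_of_pos_left h1 (by positivity)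
      _ = n * r * ((k + 1) * r) := by ring)
  obtain ⟨x0, hx0⟩ := Function.ne_iff.1 hc0
  obtain ⟨γu, hγu, hu⟩ := S.wronskian _ (S.u_ind n)
  obtain ⟨γv, hγv, hv⟩ := S.wronskian _ (S.u_ind (k + 1))
  obtain ⟨γd, hγd, b, hb⟩ := S.exists_disc
  obtain ⟨Pu, zu, hPu, hPuz⟩ := S.exists_norm γu hγu
  obtain ⟨Pv, zv, hPv, hPvz⟩ := S.exists_norm γv hγv
  obtain ⟨Pd, zd, hPd, hPdz⟩ := S.exists_norm γd hγd
  refine ⟨Pu * Pv * Pd * S.e * C (c x0) * C (((r * k * r).factorial : ℕ) : O), ?_, n + S.w, ?_⟩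
  · refine mul_ne_zero (mul_ne_zero (mul_ne_zero (mul_ne_zero (mul_ne_zero hPu hPv) hPd) S.e_ne)
      (C_ne_zero.2 hx0)) (C_ne_zero.2 ?_)
    exact_mod_cast Nat.factorial_ne_zero _
  intro p _ _ hβ s Q σa hs
  simp only [Polynomial.map_mul, map_C] at hβ
  have hβ1 := right_ne_zero_of_mul hβ
  have hβ2 := left_ne_zero_of_mul hβ
  have hβ3 := right_ne_zero_of_mul hβ2
  have hβ4 := left_ne_zero_of_mul hβ2
  have hβ5 := left_ne_zero_of_mul hβ4
  have hβ6 := right_ne_zero_of_mul hβ5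
  have hβ7 := left_ne_zero_of_mul hβ5
  have hβ8 := right_ne_zero_of_mul hβ7
  have hβ9 := left_ne_zero_of_mul hβ7
  have hfac : ((r * k * r).factorial : O) ∉ p := by
    intro h
    apply hβ1
    rw [Ideal.Quotient.eq_zero_iff_mem.2 h, C_0]
  have hcx : c x0 ∉ p := by
    intro h
    apply hβ3
    rw [Ideal.Quotient.eq_zero_iff_mem.2 h, C_0]
  obtain ⟨P, hP, hPdeg⟩ := S.H_norm n (k + 1) (Nat.card (O ⧸ p)) c
  have hPne := S.P_ne p n (k + 1) c γd γu γv Pd Pu Pv zd zu zv hPdz hPuz hPvz hβ6 hβ9 hβ8 b hb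
    hu hv x0 hcx P hP
  have hdvd : ∀ a ∈ s, (X - C a) ^
      (r * k * (Finset.univ.filter fun τ : G => τ⁻¹ * σa a * τ = σ).card) ∣
      P.map (Ideal.Quotient.mk p) := by
    intro a ha
    obtain ⟨h1, h2, h3⟩ := hs a ha
    refine S.dvd_P p a (Q a) h1 n (k + 1) (r * k) c σ (σa a) hc h2 ?_ hfac P hP
    intro h0
    apply h3
    simp [h0]
  let _ := Ideal.Quotient.field p
  have hprod : ∏ a ∈ s, (X - C a) ^
      (r * k * (Finset.univ.filter fun τ : G => τ⁻¹ * σa a * τ = σ).card) ∣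
      P.map (Ideal.Quotient.mk p) := by
    refine Finset.prod_dvd_of_coprime ?_ hdvd
    intro a _ a' _ haa
    exact (pairwise_coprime_X_sub_C Function.injective_id haa).pow
  have h1 := natDegree_le_of_dvd hprod hPne
  rw [natDegree_prod_of_monic _ _ (fun a _ => (monic_X_sub_C a).pow _)] at h1
  simp only [natDegree_pow, natDegree_X_sub_C, mul_one, ← Finset.mul_sum] at h1
  have h2 := h1.trans ((natDegree_map_le).trans hPdeg)
  rw [mul_assoc] at h2
  exact Nat.le_of_mul_le_mul_left h2 hr0

end StSetup

namespace StSetup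

variable {O R G ι : Type*} [CommRing O] [CommRing R] [Algebra O R] [Algebra O[X] R]
    [IsScalarTower O O[X] R] [Group G] [Fintype G] [MulSemiringAction G R]

theorem count (S : StSetup O R G ι) [IsDomain O] [CharZero O] [IsDomain R] [Fintype ι]
    [DecidableEq G]
    [Algebra.IsInvariant O[X] R G] [SMulCommClass G O[X] R]
    (hcard : Fintype.card ι = Fintype.card G) (T : Finset G)
    (hT : ∀ σ ∈ T, ∀ τ : G, τ⁻¹ * σ * τ ∈ T) (ε : ℝ) (hε : 0 < ε) :
    ∃ β : O[X], β ≠ 0 ∧ ∃ N : ℝ, ∀ (p : Ideal O) [p.IsMaximal] [Finite (O ⧸ p)],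
      β.map (Ideal.Quotient.mk p) ≠ 0 →
      ∀ (s : Finset (O ⧸ p)) (Q : O ⧸ p → Ideal R) (σa : O ⧸ p → G),
      (∀ a ∈ s, (∀ f : O[X], algebraMap O[X] R f ∈ Q a ↔
          (f.map (Ideal.Quotient.mk p)).eval a = 0) ∧
        (∀ x : R, σa a • x - x ^ Nat.card (O ⧸ p) ∈ Q a) ∧
        (β.map (Ideal.Quotient.mk p)).eval a ≠ 0 ∧ σa a ∈ T) →
      (s.card : ℝ) ≤ ((T.card : ℝ) / (Fintype.card G : ℝ) + ε) * (Nat.card (O ⧸ p) : ℝ) + N := by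
  obtain ⟨k, hk⟩ := exists_nat_gt ((1 + S.w : ℝ) / ε)
  have hk0 : (0 : ℝ) < k := lt_of_le_of_lt (by positivity) hk
  have hk1 : (1 + S.w : ℝ) ≤ ε * k := by
    rw [div_lt_iff₀ hε] at hk
    linarith
  choose β hβ N hN using fun σ => S.stepanov hcard σ k
  refine ⟨∏ σ ∈ T, β σ, Finset.prod_ne_zero_iff.2 fun σ _ => hβ σ, ∑ σ ∈ T, (N σ : ℝ), ?_⟩
  intro p _ _ hβp s Q σa hs
  rw [Polynomial.map_prod] at hβp
  set q := Nat.card (O ⧸ p)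
  have h1 : ∀ σ ∈ T, k * ∑ a ∈ s, (Finset.univ.filter fun τ : G => τ⁻¹ * σa a * τ = σ).card ≤
        N σ + q * (k + 1 + S.w) := by
    intro σ hσ
    refine hN σ p ?_ s Q σa ?_
    · intro h0
      exact hβp (Finset.prod_eq_zero hσ h0)
    · intro a ha
      obtain ⟨h2, h3, h4, h5⟩ := hs a ha
      refine ⟨h2, h3, fun h0 => h4 ?_⟩
      rw [Polynomial.map_prod, eval_prod]
      exact Finset.prod_eq_zero hσ h0
  have h2 := Finset.sum_le_sum h1
  rw [← Finset.mul_sum, Finset.sum_comm] at h2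
  have h3 : ∀ a ∈ s, ∑ σ ∈ T, (Finset.univ.filter fun τ : G => τ⁻¹ * σa a * τ = σ).card =
      Fintype.card G := by
    intro a ha
    rw [← Finset.card_univ]
    exact (Finset.card_eq_sum_card_fiberwise (f := fun τ : G => τ⁻¹ * σa a * τ)
      (fun τ _ => hT _ (hs a ha).2.2.2 τ)).symm
  rw [Finset.sum_congr rfl h3, Finset.sum_const, Finset.sum_add_distrib, Finset.sum_const,
    smul_eq_mul, smul_eq_mul] at h2
  have h4 : (k : ℝ) * (s.card * Fintype.card G) ≤
      ∑ σ ∈ T, (N σ : ℝ) + T.card * (q * (k + 1 + S.w)) := by exact_mod_cast h2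
  have hr : (0 : ℝ) < Fintype.card G := by exact_mod_cast Fintype.card_pos
  have hr1 : (1 : ℝ) ≤ Fintype.card G := by exact_mod_cast Fintype.card_pos
  have hkk : (1 : ℝ) ≤ k := by
    have : 0 < k := by exact_mod_cast hk0
    exact_mod_cast this
  have hTr : (T.card : ℝ) ≤ Fintype.card G := by exact_mod_cast Finset.card_le_univ T
  have hNN : 0 ≤ ∑ σ ∈ T, (N σ : ℝ) := Finset.sum_nonneg fun _ _ => Nat.cast_nonneg _
  refine le_of_mul_le_mul_left ?_ (mul_pos hk0 hr)
  have e1 : (k : ℝ) * Fintype.card G *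
      (((T.card : ℝ) / (Fintype.card G : ℝ) + ε) * (q : ℝ) + ∑ σ ∈ T, (N σ : ℝ)) =
      k * T.card * q + Fintype.card G * q * (ε * k) +
        (k * Fintype.card G) * ∑ σ ∈ T, (N σ : ℝ) := by
    field_simp
  rw [e1]
  have e2 : ∑ σ ∈ T, (N σ : ℝ) ≤ (k * Fintype.card G) * ∑ σ ∈ T, (N σ : ℝ) :=
    le_mul_of_one_le_left hNN (one_le_mul_of_one_le_of_one_le hkk hr1)
  have e3 : (T.card : ℝ) * q * (1 + S.w) ≤ Fintype.card G * q * (ε * k) := by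
    apply mul_le_mul _ hk1 (by positivity) (by positivity)
    exact mul_le_mul_of_nonneg_right hTr (by positivity)
  nlinarith [e2, e3, h4]

end StSetup

section deriv

variable (O L : Type*) [CommRing O] [Field L] [Algebra O[X] L] [Algebra O L] [IsScalarTower O O[X] L]

theorem st_etale (F : Type*) [Field F] [Algebra O[X] F] [IsFractionRing O[X] F] [Algebra F L]
    [Algebra.IsSeparable F L] [IsScalarTower O[X] F L] : Algebra.FormallyEtale O[X] L := by
  have := Algebra.FormallyEtale.of_isLocalization (Rₘ := F) (nonZeroDivisors O[X])
  have := Algebra.FormallyEtale.of_isSeparable F L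
  exact Algebra.FormallyEtale.comp O[X] F L

theorem st_exists_der (F : Type*) [Field F] [Algebra O[X] F] [IsFractionRing O[X] F] [Algebra F L]
    [Algebra.IsSeparable F L] [IsScalarTower O[X] F L] : ∃ D : Derivation O L L, D (algebraMap O[X] L X) = 1 := by
  have := st_etale O L F
  let d : Derivation O O[X] L := mkDerivation O (1 : L)
  let ψ : TensorProduct O[X] L (KaehlerDifferential O O[X]) →ₗ[L] L :=
    LinearMap.liftBaseChange L d.liftKaehlerDifferential
  let φ : KaehlerDifferential O L →ₗ[L] L :=
    ψ ∘ₗ (KaehlerDifferential.tensorKaehlerEquivOfFormallyEtale O O[X] L).symm.toLinearMap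
  refine ⟨φ.compDer (KaehlerDifferential.D O L), ?_⟩
  change ψ ((KaehlerDifferential.tensorKaehlerEquivOfFormallyEtale O O[X] L).symm
    (KaehlerDifferential.D O L (algebraMap O[X] L X))) = 1
  rw [KaehlerDifferential.tensorKaehlerEquivOfFormallyEtale_symm_D_algebraMap]
  simp [ψ, d]

theorem st_der_unique (F : Type*) [Field F] [Algebra O[X] F] [IsFractionRing O[X] F] [Algebra F L]
    [Algebra.IsSeparable F L] [IsScalarTower O[X] F L] (D : Derivation O L L) (hD : D (algebraMap O[X] L X) = 0) : D = 0 := by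
  have := st_etale O L F
  have h0 : ∀ P : O[X], D (algebraMap O[X] L P) = 0 := by
    intro P
    have h1 : algebraMap O[X] L P = aeval (algebraMap O[X] L X) P := by
      rw [aeval_algebraMap_apply, aeval_X_left_apply]
    rw [h1, D.map_aeval, hD, smul_zero]
  let D' : Derivation O[X] L L := Derivation.mk'
    { toFun := D
      map_add' := D.map_add
      map_smul' := by
        intro P x
        rw [Algebra.smul_def, D.leibniz, h0, smul_zero, add_zero]
        simp [Algebra.smul_def] } (fun a b => D.leibniz a b)
  have hs : Subsingleton (KaehlerDifferential O[X] L) := inferInstance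
  ext x
  have : D' x = D'.liftKaehlerDifferential (KaehlerDifferential.D O[X] L x) := by
    rw [Derivation.liftKaehlerDifferential_comp_D]
  change D' x = 0
  rw [this, Subsingleton.elim (KaehlerDifferential.D O[X] L x) 0, map_zero]

variable {O L}

theorem st_der_G (F : Type*) [Field F] [Algebra O[X] F] [IsFractionRing O[X] F] [Algebra F L]
    [Algebra.IsSeparable F L] [IsScalarTower O[X] F L]
    (D : Derivation O L L) (hD : D (algebraMap O[X] L X) = 1) (σ : L ≃ₐ[F] L) (x : L) :
    D (σ x) = σ (D x) := by
  have hσ : ∀ P : O[X], σ (algebraMap O[X] L P) = algebraMap O[X] L P := by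
    intro P
    rw [IsScalarTower.algebraMap_apply O[X] F L, AlgEquiv.commutes]
  have hσ' : ∀ c : O, σ (algebraMap O L c) = algebraMap O L c := by
    intro P
    rw [IsScalarTower.algebraMap_apply O O[X] L, hσ]
  have hσs : ∀ P : O[X], σ.symm (algebraMap O[X] L P) = algebraMap O[X] L P := by
    intro P
    rw [IsScalarTower.algebraMap_apply O[X] F L, AlgEquiv.commutes]
  have hσs' : ∀ c : O, σ.symm (algebraMap O L c) = algebraMap O L c := by
    intro P
    rw [IsScalarTower.algebraMap_apply O O[X] L, hσs]
  let D' : Derivation O L L := Derivation.mk'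
    { toFun := fun x => σ.symm (D (σ x))
      map_add' := by intro x y; simp
      map_smul' := by
        intro c x
        simp only [Algebra.smul_def, map_mul, hσ', D.leibniz, RingHom.id_apply,
          D.map_algebraMap, mul_zero, add_zero, hσs', Algebra.algebraMap_self] } (fun a b => by
        simp [D.leibniz])
  have h1 : D' - D = 0 := by
    apply st_der_unique O L F
    have : D' (algebraMap O[X] L X) = 1 := by
      change σ.symm (D (σ _)) = 1
      rw [hσ, hD, map_one]
    rw [Derivation.sub_apply, this, hD, sub_self]
  have h2 : D' x = D x := by rw [sub_eq_zero.1 h1]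
  change σ.symm (D (σ x)) = D x at h2
  rw [← h2, AlgEquiv.apply_symm_apply]

theorem st_der_alg (D : Derivation O L L) (hD : D (algebraMap O[X] L X) = 1) (P : O[X]) :
    D (algebraMap O[X] L P) = algebraMap O[X] L (derivative P) := by
  have h1 : ∀ P : O[X], algebraMap O[X] L P = aeval (algebraMap O[X] L X) P := by
    intro P
    rw [aeval_algebraMap_apply, aeval_X_left_apply]
  rw [h1 P, D.map_aeval, hD, smul_eq_mul, mul_one, ← h1]

theorem st_const_poly [IsDomain O] [CharZero O] (P Q : O[X]) (hQ : Q ≠ 0) (h : derivative P * Q = P * derivative Q) :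
    C Q.leadingCoeff * P = C P.leadingCoeff * Q := by
  -- degrees agree
  have key : ∀ P : O[X], P ≠ 0 → derivative P * Q = P * derivative Q →
      P.natDegree = Q.natDegree := by
    intro P hP h
    have h1 := congrArg (fun f => (X * f).coeff (P.natDegree + Q.natDegree)) h
    have hm : ∀ A : O[X], (X * derivative A).natDegree ≤ A.natDegree := by
      intro A
      rcases Nat.eq_zero_or_pos A.natDegree with h0 | h0
      · rw [eq_C_of_natDegree_eq_zero h0]; simp
      · refine natDegree_mul_le.trans ?_
        have := natDegree_derivative_lt (p := A) (by omega)
        have := natDegree_X_le (R := O)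
        omega
    have hc : ∀ A : O[X], (X * derivative A).coeff A.natDegree =
        A.leadingCoeff * (A.natDegree : O) := by
      intro A
      rcases Nat.eq_zero_or_pos A.natDegree with h0 | h0
      · rw [h0]; simp
      · obtain ⟨d, hd⟩ := Nat.exists_eq_succ_of_ne_zero h0.ne'
        rw [hd, coeff_X_mul, coeff_derivative, leadingCoeff, hd]
        push_cast; ring
    beta_reduce at h1
    rw [← mul_assoc, mul_left_comm, coeff_mul_add_eq_of_natDegree_le (hm P) le_rfl,
      coeff_mul_add_eq_of_natDegree_le le_rfl (hm Q), hc, hc] at h1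
    have h2 : P.leadingCoeff * Q.leadingCoeff * (P.natDegree : O) =
        P.leadingCoeff * Q.leadingCoeff * (Q.natDegree : O) := by
      simp only [coeff_natDegree] at h1
      linear_combination h1
    have h3 := mul_left_cancel₀ (mul_ne_zero (leadingCoeff_ne_zero.2 hP)
      (leadingCoeff_ne_zero.2 hQ)) h2
    exact_mod_cast h3
  by_cases hP : P = 0
  · simp [hP]
  by_contra hne
  have hdeg := key P hP h
  have h2 := key (C Q.leadingCoeff * P - C P.leadingCoeff * Q) (sub_ne_zero.2 hne) (by
    simp only [derivative_sub, derivative_mul, derivative_C, zero_mul, zero_add]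
    linear_combination C Q.leadingCoeff * h)
  have h3 : (C Q.leadingCoeff * P - C P.leadingCoeff * Q).coeff Q.natDegree = 0 := by
    rw [coeff_sub, coeff_C_mul, coeff_C_mul, coeff_natDegree, ← hdeg, coeff_natDegree]
    ring
  rw [← h2, coeff_natDegree, leadingCoeff_eq_zero] at h3
  exact hne (sub_eq_zero.1 h3)

theorem st_const_F (F : Type*) [Field F] [Algebra O[X] F] [IsFractionRing O[X] F] [Algebra F L]
    [IsScalarTower O[X] F L] [IsDomain O] [CharZero O]
    (D : Derivation O L L) (hD : D (algebraMap O[X] L X) = 1) (c : F)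
    (hc : D (algebraMap F L c) = 0) : IsAlgebraic O (algebraMap F L c) := by
  obtain ⟨P, Q, hQ, rfl⟩ := IsFractionRing.div_surjective (A := O[X]) c
  have hQ0 : Q ≠ 0 := nonZeroDivisors.ne_zero hQ
  have hinj : Function.Injective (algebraMap O[X] L) := by
    rw [IsScalarTower.algebraMap_eq O[X] F L]
    exact (algebraMap F L).injective.comp (IsFractionRing.injective O[X] F)
  have hQL : algebraMap O[X] L Q ≠ 0 := fun h => hQ0 (hinj (by rw [h, map_zero]))
  rw [map_div₀, ← IsScalarTower.algebraMap_apply, ← IsScalarTower.algebraMap_apply] at hc ⊢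
  rw [Derivation.leibniz_div, st_der_alg D hD, st_der_alg D hD, smul_eq_mul, smul_eq_mul,
    smul_eq_mul, mul_eq_zero, sub_eq_zero] at hc
  have h1 := hc.resolve_left (pow_ne_zero _ (inv_ne_zero hQL))
  rw [← map_mul, ← map_mul] at h1
  have h2 := st_const_poly P Q hQ0 (by rw [mul_comm]; exact hinj h1)
  have h3 := congrArg (algebraMap O[X] L) h2
  have hC : ∀ a : O, algebraMap O[X] L (C a) = algebraMap O L a :=
    fun a => (IsScalarTower.algebraMap_apply O O[X] L a).symm
  rw [map_mul, map_mul, hC, hC] at h3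
  refine ⟨C Q.leadingCoeff * X - C P.leadingCoeff, ?_, ?_⟩
  · intro h
    have := congrArg (fun f => coeff f 1) h
    simp [coeff_C] at this
    exact hQ0 this
  · simp only [map_sub, map_mul, aeval_C, aeval_X]
    rw [sub_eq_zero, ← mul_div_assoc, div_eq_iff hQL, h3]

theorem st_const (F : Type*) [Field F] [Algebra O[X] F] [IsFractionRing O[X] F] [Algebra F L]
    [Algebra.IsSeparable F L] [IsScalarTower O[X] F L] [IsDomain O] [CharZero O]
    (D : Derivation O L L) (hD : D (algebraMap O[X] L X) = 1) (x : L)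
    (hx : D x = 0) : IsAlgebraic O x := by
  have hIntegral : IsIntegral F x := Algebra.IsIntegral.isIntegral x
  have hδ : ∀ c : F, ∃ c' : F, D (algebraMap F L c) = algebraMap F L c' := by
    intro c
    obtain ⟨P, Q, hQ, rfl⟩ := IsFractionRing.div_surjective (A := O[X]) c
    refine ⟨(algebraMap O[X] F Q)⁻¹ ^ 2 * algebraMap O[X] F (Q * derivative P - P * derivative Q), ?_⟩
    rw [map_div₀, ← IsScalarTower.algebraMap_apply, ← IsScalarTower.algebraMap_apply,
      Derivation.leibniz_div, st_der_alg D hD, st_der_alg D hD]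
    simp only [smul_eq_mul, map_mul, map_pow, map_inv₀, map_sub, ← IsScalarTower.algebraMap_apply]
  choose δ hδ using hδ
  set p := minpoly F x with hp
  have hmonic : p.Monic := minpoly.monic hIntegral
  have h0 : aeval x p = 0 := minpoly.aeval F x
  have hpow : ∀ i : ℕ, D (x ^ i) = 0 := by
    intro i; rw [D.leibniz_pow, hx]; simp
  have hterm : ∀ i, D (algebraMap F L (p.coeff i) * x ^ i) = algebraMap F L (δ (p.coeff i)) * x ^ i := by
    intro i
    rw [D.leibniz, hpow, smul_zero, zero_add, hδ, smul_eq_mul, mul_comm]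
  have h1 : ∑ i : Fin p.natDegree, δ (p.coeff i) • x ^ (i : ℕ) = 0 := by
    have h2 := congrArg D h0
    rw [aeval_eq_sum_range, Finset.sum_range_succ, map_zero, map_add, map_sum] at h2
    simp only [Algebra.smul_def, hterm] at h2
    have h3 : D (algebraMap F L (p.coeff p.natDegree) * x ^ p.natDegree) = 0 := by
      rw [coeff_natDegree, hmonic.leadingCoeff, map_one, one_mul, hpow]
    rw [← hterm, h3, add_zero] at h2
    simp only [Algebra.smul_def]
    rw [← h2, Finset.sum_range]
  have h4 := Fintype.linearIndependent_iff.1 (linearIndependent_pow (K := F) x) _ h1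
  have hcoef : ∀ i, IsAlgebraic O (algebraMap F L (p.coeff i)) := by
    intro i
    apply st_const_F F D hD
    rw [hδ]
    rcases lt_or_ge i p.natDegree with hi | hi
    · rw [h4 ⟨i, hi⟩, map_zero]
    · rw [← hδ]
      rcases hi.eq_or_lt with hi | hi
      · rw [← hi, coeff_natDegree, hmonic.leadingCoeff, map_one, D.map_one_eq_zero]
      · rw [coeff_eq_zero_of_natDegree_lt hi, map_zero, map_zero]
  let A0 := Subalgebra.algebraicClosure O L
  have hA0 : Algebra.IsAlgebraic O A0 := inferInstance
  have hl : p.map (algebraMap F L) ∈ lifts (algebraMap A0 L) := by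
    rw [lifts_iff_coeff_lifts]
    intro i
    rw [coeff_map]
    exact ⟨⟨_, hcoef i⟩, rfl⟩
  obtain ⟨g, hg⟩ := (mem_lifts _).1 hl
  have hA : IsAlgebraic A0 x := by
    refine ⟨g, ?_, ?_⟩
    · rintro rfl
      rw [Polynomial.map_zero] at hg
      exact (hmonic.map (algebraMap F L)).ne_zero hg.symm
    · rw [aeval_def, ← eval_map, hg, eval_map, ← aeval_def, h0]
  exact hA.restrictScalars O

end deriv

section weight
set_option linter.unusedSectionVars false

variable {O L : Type*} [CommRing O] [Field L] [Algebra O[X] L] [Algebra O L]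
  [IsScalarTower O O[X] L]

variable (O L) in
/-- the ring `O[1/t]` -/
noncomputable def StA : Subalgebra O L := (aeval (algebraMap O[X] L X)⁻¹ : O[X] →ₐ[O] L).range

variable (O) in
/-- the weight at infinity -/
def StW (x : L) (n : ℕ) : Prop := IsIntegral (StA O L) (x * (algebraMap O[X] L X)⁻¹ ^ n)

theorem StW_inv : IsIntegral (StA O L) (algebraMap O[X] L X)⁻¹ :=
  isIntegral_algebraMap (R := StA O L) (x := ⟨(algebraMap O[X] L X)⁻¹, X, by simp⟩)

theorem StW_add (x y : L) (n : ℕ) (hx : StW O x n) (hy : StW O y n) : StW O (x + y) n := by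
  unfold StW
  rw [add_mul]
  exact IsIntegral.add hx hy

theorem StW_mul (x y : L) (m n : ℕ) (hx : StW O x m) (hy : StW O y n) : StW O (x * y) (m + n) := by
  unfold StW
  rw [pow_add, mul_mul_mul_comm]
  exact IsIntegral.mul hx hy

theorem StW_mono (x : L) (m n : ℕ) (h : m ≤ n) (hx : StW O x m) : StW O x n := by
  unfold StW
  obtain ⟨k, rfl⟩ := Nat.exists_eq_add_of_le h
  rw [pow_add, ← mul_assoc]
  exact IsIntegral.mul hx (StW_inv.pow k)

theorem StW_const (c : O) : StW O (algebraMap O L c) 0 := by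
  unfold StW
  rw [pow_zero, mul_one]
  exact isIntegral_algebraMap (R := StA O L) (x := algebraMap O (StA O L) c)

theorem StW_sum {α : Type*} (s : Finset α) (f : α → L) (n : ℕ)
    (h : ∀ a ∈ s, StW O (f a) n) : StW O (∑ a ∈ s, f a) n := by
  refine Finset.sum_induction f (fun x => StW O x n) (fun x y => StW_add x y n) ?_ h
  have := StW_const (L := L) (0 : O)
  rw [map_zero] at this
  exact StW_mono _ _ _ (Nat.zero_le _) this

theorem StW_X_pow (ht : algebraMap O[X] L X ≠ 0) (i : ℕ) : StW O (algebraMap O[X] L X ^ i) i := by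
  unfold StW
  rw [← mul_pow, mul_inv_cancel₀ ht, one_pow]
  exact isIntegral_one

theorem StW_alg (ht : algebraMap O[X] L X ≠ 0) (P : O[X]) (n : ℕ) (h : P.natDegree ≤ n) :
    StW O (algebraMap O[X] L P) n := by
  rw [P.as_sum_range_C_mul_X_pow' (n := n + 1) (by omega), map_sum]
  apply StW_sum
  intro i hi
  rw [map_mul, map_pow]
  have h1 := StW_mul _ _ _ _ (StW_const (L := L) (P.coeff i)) (StW_X_pow ht i)
  rw [IsScalarTower.algebraMap_apply O O[X] L] at h1
  refine StW_mono _ _ _ ?_ h1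
  have := Finset.mem_range.1 hi
  omega

theorem StW_map (σ : L →+* L) (hσ : ∀ P : O[X], σ (algebraMap O[X] L P) = algebraMap O[X] L P)
    (x : L) (n : ℕ) (hx : StW O x n) : StW O (σ x) n := by
  unfold StW at *
  have hC : ∀ c : O, σ (algebraMap O L c) = algebraMap O L c := by
    intro c; rw [IsScalarTower.algebraMap_apply O O[X] L, hσ]
  have h1 : σ (x * (algebraMap O[X] L X)⁻¹ ^ n) = σ x * (algebraMap O[X] L X)⁻¹ ^ n := by
    rw [map_mul, map_pow, map_inv₀, hσ]
  rw [← h1]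
  have hfix : ∀ a : StA O L, σ a = a := by
    rintro ⟨a, P, rfl⟩
    simp only [AlgHom.toRingHom_eq_coe, RingHom.coe_coe]
    rw [aeval_def, hom_eval₂, map_inv₀, hσ]
    congr 1
    ext c; exact hC c
  obtain ⟨g, hg, hg0⟩ := hx
  refine ⟨g, hg, ?_⟩
  have := congrArg σ hg0
  rw [hom_eval₂, map_zero] at this
  rw [← this]
  congr 1
  ext c; exact (hfix c).symm

theorem StW_exists (ht : algebraMap O[X] L X ≠ 0) (x : L) (hx : IsIntegral O[X] x) :
    ∃ n, StW O x n := by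
  obtain ⟨p, hp, hp0⟩ := hx
  obtain ⟨n, hn⟩ : ∃ n, ∀ i ∈ p.support, (p.coeff i).natDegree ≤ n :=
    ⟨p.support.sup fun i => (p.coeff i).natDegree, fun i hi =>
      Finset.le_sup (f := fun i => (p.coeff i).natDegree) hi⟩
  refine ⟨n, ?_⟩
  set s := (algebraMap O[X] L X)⁻¹ ^ n with hs
  let g := (p.map (algebraMap O[X] L)).scaleRoots s
  have hgm : g.Monic := (monic_scaleRoots_iff s).2 (hp.map _)
  have hg0 : g.eval (x * s) = 0 := by
    have : (p.map (algebraMap O[X] L)).eval x = 0 := by rw [eval_map]; exact hp0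
    have h2 := scaleRoots_eval₂_mul (p := p.map (algebraMap O[X] L)) (RingHom.id L) (r := x) (s := s)
    simp only [RingHom.id_apply] at h2
    rw [eval₂_id, eval₂_id, this, mul_zero] at h2
    rw [mul_comm]; exact h2
  let T := integralClosure (StA O L) L
  have hl : g ∈ lifts (algebraMap T L) := by
    rw [lifts_iff_coeff_lifts]
    intro i
    suffices IsIntegral (StA O L) (g.coeff i) from ⟨⟨_, this⟩, rfl⟩
    rw [coeff_scaleRoots, hp.natDegree_map, coeff_map]
    by_cases hi : i ∈ p.support
    swap
    · rw [notMem_support_iff.1 hi, map_zero, zero_mul]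
      exact isIntegral_zero
    rcases (le_natDegree_of_mem_supp i hi).eq_or_lt with h | h
    · rw [h, coeff_natDegree, hp.leadingCoeff, Nat.sub_self]
      simpa using isIntegral_one
    · have h3 := StW_alg ht (p.coeff i) (n * (p.natDegree - i)) ((hn i hi).trans
        (Nat.le_mul_of_pos_right _ (by omega)))
      rw [hs, ← pow_mul]
      exact h3
  obtain ⟨g', hg', -, hg'm⟩ := lifts_and_natDegree_eq_and_monic hl hgm
  have hT : IsIntegral T (x * s) := ⟨g', hg'm, by rw [← eval_map, hg', hg0]⟩
  exact isIntegral_trans (R := StA O L) (A := T) _ hT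

theorem StW_deg [IsDomain O] (hinj : Function.Injective (algebraMap O[X] L)) (P : O[X]) (n : ℕ)
    (h : StW O (algebraMap O[X] L P) n) : P.natDegree ≤ n := by
  by_contra! hlt
  set t := algebraMap O[X] L X with ht
  have ht0 : t ≠ 0 := fun h0 => X_ne_zero (hinj (by rw [← ht, h0, map_zero]))
  have hP0 : P ≠ 0 := by rintro rfl; simp at hlt
  obtain ⟨g, hg, hg0⟩ := h
  have ha : ∀ i, ∃ a : O[X], aeval t⁻¹ a = algebraMap (StA O L) L (g.coeff i) := by
    intro i
    obtain ⟨a, ha⟩ := (g.coeff i).2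
    exact ⟨a, ha⟩
  choose a ha using ha
  set d := g.natDegree with hd
  obtain ⟨M, hM⟩ : ∃ M, ∀ i ∈ Finset.range d, (a i).natDegree ≤ M :=
    ⟨(Finset.range d).sup fun i => (a i).natDegree, fun i hi =>
      Finset.le_sup (f := fun i => (a i).natDegree) hi⟩
  have hrefl : ∀ i ∈ Finset.range d, algebraMap O[X] L (reflect M (a i)) =
      aeval t⁻¹ (a i) * t ^ M := by
    intro i hi
    let _ : Invertible t⁻¹ := invertibleOfNonzero (inv_ne_zero ht0)
    have h1 := eval₂_reflect_mul_pow (algebraMap O L) t⁻¹ M (a i) (hM i hi)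
    rw [invOf_eq_inv, inv_inv] at h1
    have h2 : algebraMap O[X] L (reflect M (a i)) = eval₂ (algebraMap O L) t (reflect M (a i)) := by
      rw [← aeval_def, ht, aeval_algebraMap_apply, aeval_X_left_apply]
    rw [h2, aeval_def, ← h1, mul_assoc, ← mul_pow, inv_mul_cancel₀ ht0, one_pow, mul_one]
  have hsum : P ^ d * X ^ M +
      ∑ i ∈ Finset.range d, reflect M (a i) * P ^ i * X ^ (n * (d - i)) = 0 := by
    apply hinj
    rw [eval₂_eq_sum_range, Finset.sum_range_succ, ← hd] at hg0
    rw [map_add, map_sum, map_zero]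
    have hlead : g.coeff d = 1 := hg
    rw [hlead, map_one, one_mul] at hg0
    have h3 : ∀ i ≤ d, (t⁻¹ ^ n) ^ i * t ^ (n * d + M) = t ^ (n * (d - i)) * t ^ M := by
      intro i hi
      obtain ⟨j, hj⟩ := Nat.exists_eq_add_of_le hi
      rw [hj, Nat.add_sub_cancel_left, mul_add, pow_add, pow_add, ← pow_mul, inv_pow, mul_assoc,
        inv_mul_cancel_left₀ (pow_ne_zero _ ht0)]
    have h4 := congrArg (fun y => y * t ^ (n * d + M)) hg0
    simp only [add_mul, zero_mul, Finset.sum_mul] at h4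
    rw [← h4, add_comm]
    congr 1
    · refine Finset.sum_congr rfl fun i hi => ?_
      rw [map_mul, map_mul, map_pow, map_pow, hrefl i hi, mul_pow, ← ht, ha, mul_assoc, mul_assoc,
        mul_assoc, mul_assoc, h3 i (Finset.mem_range.1 hi).le]
      ring
    · rw [map_mul, map_pow, map_pow, mul_pow, ← ht, mul_assoc, h3 d le_rfl]
      simp
  have hc := congrArg (fun f => coeff f (d * P.natDegree + M)) hsum
  simp only [coeff_add, finsetSum_coeff, coeff_zero] at hc
  rw [Finset.sum_eq_zero, add_zero, coeff_mul_X_pow] at hc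
  · rw [← natDegree_pow, coeff_natDegree, leadingCoeff_eq_zero] at hc
    exact pow_ne_zero _ hP0 hc
  · intro i hi
    apply coeff_eq_zero_of_natDegree_lt
    have hid := Finset.mem_range.1 hi
    have h5 : (reflect M (a i)).natDegree ≤ M := by
      refine (natDegree_reflect_le).trans (max_le le_rfl (hM i hi))
    have h6 : (reflect M (a i) * P ^ i * X ^ (n * (d - i))).natDegree ≤
        M + i * P.natDegree + n * (d - i) := by
      refine natDegree_mul_le.trans (add_le_add (natDegree_mul_le.trans
        (add_le_add h5 natDegree_pow_le)) (natDegree_X_pow_le _))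
    refine lt_of_le_of_lt h6 ?_
    obtain ⟨j, hj⟩ := Nat.exists_eq_add_of_le hid.le
    have hj0 : 0 < j := by omega
    rw [hj, Nat.add_sub_cancel_left]
    have : n * j < j * P.natDegree := by
      rw [mul_comm]; exact Nat.mul_lt_mul_of_pos_left hlt hj0
    rw [add_mul]
    omega

end weight

section setup
set_option linter.unusedSectionVars false

variable {O L : Type*} [CommRing O] [Field L] [Algebra O[X] L] [Algebra O L]
  [IsScalarTower O O[X] L] [IsDomain O] [CharZero O]
theorem st_inj (F : Type*) [Field F] [Algebra O[X] F] [IsFractionRing O[X] F] [Algebra F L]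
    [FiniteDimensional F L] [IsGalois F L] [IsScalarTower O[X] F L]
    [IsIntegrallyClosed O[X]] [IsNoetherianRing O]
    : Function.Injective (algebraMap O[X] L) := by
  rw [IsScalarTower.algebraMap_eq O[X] F L]
  exact (algebraMap F L).injective.comp (IsFractionRing.injective O[X] F)

theorem st_invariant (F : Type*) [Field F] [Algebra O[X] F] [IsFractionRing O[X] F] [Algebra F L]
    [FiniteDimensional F L] [IsGalois F L] [IsScalarTower O[X] F L]
    [IsIntegrallyClosed O[X]] [IsNoetherianRing O]
    : Algebra.IsInvariant O[X] (integralClosure O[X] L) (L ≃ₐ[F] L) := by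
  refine ⟨fun b hb => ?_⟩
  have hb' : (b : L) ∈ Set.range (algebraMap F L) := by
    rw [IsGalois.mem_range_algebraMap_iff_fixed]
    intro σ
    have := congrArg (Subtype.val) (hb σ)
    rwa [integralClosure.coe_smul] at this
  obtain ⟨c, hc⟩ := hb'
  have hIntegral : IsIntegral O[X] (algebraMap F L c) := hc ▸ b.2
  rw [isIntegral_algebraMap_iff (algebraMap F L).injective] at hIntegral
  obtain ⟨a, rfl⟩ := IsIntegrallyClosed.algebraMap_eq_of_integral hIntegral
  refine ⟨a, Subtype.ext ?_⟩
  rw [← hc, ← IsScalarTower.algebraMap_apply]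
  rfl

/-- generators -/
theorem st_gens (F : Type*) [Field F] [Algebra O[X] F] [IsFractionRing O[X] F] [Algebra F L]
    [FiniteDimensional F L] [IsGalois F L] [IsScalarTower O[X] F L]
    [IsIntegrallyClosed O[X]] [IsNoetherianRing O]
    : ∃ (m : ℕ) (r : Fin m → integralClosure O[X] L),
    ∀ x, ∃ f : Fin m → O[X], x = ∑ k, algebraMap O[X] _ (f k) * r k := by
  have := IsIntegralClosure.finite O[X] F L (integralClosure O[X] L)
  obtain ⟨m, r, hr⟩ := Module.Finite.exists_fin (R := O[X]) (M := integralClosure O[X] L)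
  refine ⟨m, r, fun x => ?_⟩
  have hx : x ∈ Submodule.span O[X] (Set.range r) := hr ▸ Submodule.mem_top
  obtain ⟨f, hf⟩ := (Submodule.mem_span_range_iff_exists_fun O[X]).1 hx
  refine ⟨f, ?_⟩
  rw [← hf]
  simp [Algebra.smul_def]

theorem st_exists_E (F : Type*) [Field F] [Algebra O[X] F] [IsFractionRing O[X] F] [Algebra F L]
    [FiniteDimensional F L] [IsGalois F L] [IsScalarTower O[X] F L]
    [IsIntegrallyClosed O[X]] [IsNoetherianRing O]
    (D : Derivation O L L) (hD : D (algebraMap O[X] L X) = 1) :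
    ∃ (e : O[X]) (E : Derivation O (integralClosure O[X] L) (integralClosure O[X] L)), e ≠ 0 ∧
      ∀ x, (E x : L) = algebraMap O[X] L e * D x := by
  classical
  obtain ⟨m, r, hr⟩ := st_gens (O := O) (L := L) F
  obtain ⟨e, he, hIntegral⟩ := exists_integral_multiples O[X] F
    (Finset.univ.image (fun k => D (r k : L)))
  have key : ∀ x : integralClosure O[X] L, IsIntegral O[X] (algebraMap O[X] L e * D x) := by
    intro x
    obtain ⟨f, rfl⟩ := hr x
    have : algebraMap O[X] L e * D ((∑ k, algebraMap O[X] _ (f k) * r k : integralClosure O[X] L) : L)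
       = ∑ k, (algebraMap O[X] L (f k) * (e • D (r k : L)) +
          (r k : L) * (algebraMap O[X] L (e * derivative (f k)))) := by
      rw [AddSubmonoidClass.coe_finsetSum, map_sum, Finset.mul_sum]
      refine Finset.sum_congr rfl fun k _ => ?_
      rw [MulMemClass.coe_mul]
      have h2 : ((algebraMap O[X] (integralClosure O[X] L) (f k) : integralClosure O[X] L) : L) =
        algebraMap O[X] L (f k) := rfl
      rw [h2, D.leibniz, st_der_alg D hD, Algebra.smul_def e, map_mul]
      simp only [smul_eq_mul]
      ring
    rw [this]
    refine IsIntegral.sum _ fun k _ => ?_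
    refine IsIntegral.add (IsIntegral.mul isIntegral_algebraMap (hIntegral _ ?_))
      (IsIntegral.mul (r k).2 isIntegral_algebraMap)
    exact Finset.mem_image_of_mem _ (Finset.mem_univ _)
  let Elin : integralClosure O[X] L →ₗ[O] integralClosure O[X] L :=
    { toFun := fun x => ⟨algebraMap O[X] L e * D x, key x⟩
      map_add' := by
        intro x y
        apply Subtype.ext
        push_cast
        rw [map_add, mul_add]
      map_smul' := by
        intro c x
        apply Subtype.ext
        change algebraMap O[X] L e * D (c • (x : L)) = c • (algebraMap O[X] L e * D x)
        rw [D.map_smul, mul_smul_comm] }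
  refine ⟨e, Derivation.mk' Elin ?_, he, fun x => rfl⟩
  intro a b
  apply Subtype.ext
  change algebraMap O[X] L e * D ((a : L) * b) =
    (a : L) * (algebraMap O[X] L e * D b) + (b : L) * (algebraMap O[X] L e * D a)
  rw [D.leibniz]
  simp only [smul_eq_mul]
  ring

theorem st_weight_E (F : Type*) [Field F] [Algebra O[X] F] [IsFractionRing O[X] F] [Algebra F L]
    [FiniteDimensional F L] [IsGalois F L] [IsScalarTower O[X] F L]
    [IsIntegrallyClosed O[X]] [IsNoetherianRing O]
    (e : O[X]) (E : Derivation O (integralClosure O[X] L) (integralClosure O[X] L))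
    (hE : ∀ P : O[X], E (algebraMap O[X] _ P) = algebraMap O[X] _ (e * derivative P))
    {ι : Type*} [Finite ι] (ω : ι → integralClosure O[X] L) :
    ∃ w : ℕ, ∀ l i j, StW O (E^[l] (algebraMap O[X] _ X ^ i * ω j) : L) (i + w + w * l) := by
  classical
  have := Fintype.ofFinite ι
  have hinj := st_inj (O := O) (L := L) F
  have ht : algebraMap O[X] L X ≠ 0 := by
    rw [Ne, map_eq_zero_iff _ hinj]
    exact X_ne_zero
  obtain ⟨m, r, hr⟩ := st_gens (O := O) (L := L) F
  choose A hA using fun k => hr (E (r k))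
  choose b hb using fun j => hr (ω j)
  choose v hv using fun k => StW_exists (O := O) ht (r k : L) (r k).2
  let n1 := ∑ k, v k
  let n0 := ∑ j, ∑ k, (b j k).natDegree
  let c := e.natDegree + ∑ k, ∑ j, (A k j).natDegree
  have hb0 : ∀ j k, (b j k).natDegree ≤ n0 := fun j k =>
    (Finset.single_le_sum (f := fun k => (b j k).natDegree) (fun _ _ => Nat.zero_le _)
      (Finset.mem_univ k)).trans
    (Finset.single_le_sum (f := fun j => ∑ k, (b j k).natDegree) (fun _ _ => Nat.zero_le _)
      (Finset.mem_univ j))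
  have hA0 : ∀ k j, (A k j).natDegree ≤ c := fun j k =>
    ((Finset.single_le_sum (f := fun k => (A j k).natDegree) (fun _ _ => Nat.zero_le _)
      (Finset.mem_univ k)).trans
    (Finset.single_le_sum (f := fun j => ∑ k, (A j k).natDegree) (fun _ _ => Nat.zero_le _)
      (Finset.mem_univ j))).trans (Nat.le_add_left _ _)
  have hv0 : ∀ k, v k ≤ n1 := fun k => Finset.single_le_sum (f := v) (fun _ _ => Nat.zero_le _)
      (Finset.mem_univ k)
  let P : integralClosure O[X] L → ℕ → Prop := fun x n =>
    ∃ f : Fin m → O[X], (∀ k, (f k).natDegree ≤ n) ∧ x = ∑ k, algebraMap O[X] _ (f k) * r k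
  have hPE : ∀ x n, P x n → P (E x) (n + c) := by
    rintro x n ⟨f, hf, rfl⟩
    refine ⟨fun j => e * derivative (f j) + ∑ k, f k * A k j, fun j => ?_, ?_⟩
    · refine natDegree_add_le_of_degree_le ?_ (natDegree_sum_le_of_forall_le _ _ fun k _ => ?_)
      · refine natDegree_mul_le.trans ?_
        have h1 := natDegree_derivative_le (f j)
        have h2 := hf j
        have h3 : e.natDegree ≤ c := Nat.le_add_right _ _
        omega
      · exact natDegree_mul_le.trans (Nat.add_le_add (hf k) (hA0 k j))
    · rw [map_sum]
      have h1 : ∀ k, E (algebraMap O[X] _ (f k) * r k) =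
          algebraMap O[X] _ (e * derivative (f k)) * r k +
            ∑ j, algebraMap O[X] _ (f k * A k j) * r j := by
        intro k
        rw [E.leibniz, hE, hA k]
        simp only [smul_eq_mul, Finset.mul_sum, map_mul]
        rw [add_comm]
        congr 1
        · ring
        · exact Finset.sum_congr rfl fun j _ => by ring
      rw [Finset.sum_congr rfl fun k _ => h1 k, Finset.sum_add_distrib, Finset.sum_comm,
        ← Finset.sum_add_distrib]
      refine Finset.sum_congr rfl fun j _ => ?_
      rw [map_add, map_sum, add_mul, Finset.sum_mul]
  have hP0 : ∀ i j, P (algebraMap O[X] _ X ^ i * ω j) (i + n0) := by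
    intro i j
    refine ⟨fun k => X ^ i * b j k, fun k => ?_, ?_⟩
    · refine natDegree_mul_le.trans (Nat.add_le_add (natDegree_X_pow_le i) (hb0 j k))
    · conv_lhs => rw [hb j]
      rw [Finset.mul_sum]
      refine Finset.sum_congr rfl fun k _ => ?_
      rw [map_mul, map_pow, mul_assoc]
  have hPl : ∀ l i j, P (E^[l] (algebraMap O[X] _ X ^ i * ω j)) (i + n0 + c * l) := by
    intro l i j
    induction l with
    | zero => exact hP0 i j
    | succ l ih =>
      rw [Function.iterate_succ_apply']
      have := hPE _ _ ih
      rwa [add_assoc, ← Nat.mul_succ] at this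
  refine ⟨n0 + n1 + c, fun l i j => ?_⟩
  obtain ⟨f, hf, hfx⟩ := hPl l i j
  rw [hfx]
  push_cast
  refine StW_mono _ (i + n0 + c * l + n1) _ ?_ (StW_sum _ _ _ fun k _ => ?_)
  · have : c * l ≤ (n0 + n1 + c) * l := Nat.mul_le_mul_right _ (Nat.le_add_left _ _)
    omega
  · exact StW_mul _ _ _ _ (StW_alg ht _ _ (hf k)) (StW_mono _ _ _ (hv0 k) (hv k))

theorem st_setup (F : Type*) [Field F] [Algebra O[X] F] [IsFractionRing O[X] F] [Algebra F L]
    [FiniteDimensional F L] [IsGalois F L] [IsScalarTower O[X] F L]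
    [IsIntegrallyClosed O[X]] [IsNoetherianRing O]
    [Fintype (L ≃ₐ[F] L)]
    (hK : ∀ x : L, IsAlgebraic O x → ∃ a b : O, b ≠ 0 ∧ algebraMap O L b * x = algebraMap O L a) :
    ∃ s : Finset L, ∃ _ : StSetup O (integralClosure O[X] L) (L ≃ₐ[F] L) s,
      Fintype.card s = Fintype.card (L ≃ₐ[F] L) := by
  classical
  have hinj := st_inj (O := O) (L := L) F
  obtain ⟨D, hD⟩ := st_exists_der O L F
  obtain ⟨e, E, he, hE⟩ := st_exists_E F D hD
  obtain ⟨s, b, hb⟩ := FiniteDimensional.exists_is_basis_integral O[X] F L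
  have hEalg : ∀ P : O[X], E (algebraMap O[X] _ P) = algebraMap O[X] _ (e * derivative P) := by
    intro P
    apply Subtype.ext
    rw [hE]
    change _ * D (algebraMap O[X] L P) = algebraMap O[X] L _
    rw [st_der_alg D hD, map_mul]
  let ω : s → integralClosure O[X] L := fun j => ⟨b j, hb j⟩
  obtain ⟨w, hw⟩ := st_weight_E F e E hEalg ω
  refine ⟨s, ⟨E, e, he, ?_, ?_, ?_, ?_, ω, ?_, ?_, fun x n => StW O (x : L) n, ?_, ?_, ?_, ?_, ?_, ?_,
    w, hw⟩, ?_⟩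
  · rw [hEalg, derivative_X, mul_one]
  · intro σ x
    apply Subtype.ext
    rw [hE, integralClosure.coe_smul, integralClosure.coe_smul, hE]
    change algebraMap O[X] L e * D (σ x) = σ (algebraMap O[X] L e * D x)
    rw [st_der_G F D hD, map_mul, IsScalarTower.algebraMap_apply O[X] F L, AlgEquiv.commutes]
  · intro x y hxy
    exact hinj (congrArg Subtype.val hxy)
  · intro x y hy hxy
    have hy' : (y : L) ≠ 0 := fun h => hy (Subtype.ext h)
    have he' : algebraMap O[X] L e ≠ 0 := by rwa [Ne, map_eq_zero_iff _ hinj]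
    have h1 : (x : L) * D y = y * D x := by
      have := congrArg Subtype.val hxy
      push_cast at this
      rw [hE, hE] at this
      apply mul_left_cancel₀ he'
      linear_combination this
    have h2 : D ((x : L) / y) = 0 := by
      rw [Derivation.leibniz_div]
      simp only [smul_eq_mul]
      rw [h1, sub_self, mul_zero]
    obtain ⟨a, b, hb, hab⟩ := hK _ (st_const F D hD _ h2)
    refine ⟨a, b, hb, Subtype.ext ?_⟩
    change algebraMap O L b * x = algebraMap O L a * y
    rw [← hab]
    field_simp
  · have h1 : LinearIndependent O[X] (b : s → L) :=
      LinearIndependent.restrict_scalars' O[X] b.linearIndependent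
    exact LinearIndependent.of_comp ((integralClosure O[X] L).val.toLinearMap) h1
  · intro y hy
    have h1 : ∀ x : L, ∑ τ : L ≃ₐ[F] L, τ x * (y τ : L) = 0 := by
      let φ : L →ₗ[F] L := ∑ τ : L ≃ₐ[F] L, (y τ : L) • (τ : L →ₐ[F] L).toLinearMap
      have hφ : φ = 0 := by
        apply b.ext
        intro j
        have := congrArg Subtype.val (hy j)
        push_cast at this
        simp only [φ, LinearMap.sum_apply, LinearMap.smul_apply, LinearMap.zero_apply, smul_eq_mul]
        rw [← this]
        refine Finset.sum_congr rfl fun τ _ => ?_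
        rw [mul_comm]
        rfl
      intro x
      have := LinearMap.congr_fun hφ x
      simp only [φ, LinearMap.sum_apply, LinearMap.smul_apply, LinearMap.zero_apply, smul_eq_mul] at this
      rw [← this]
      refine Finset.sum_congr rfl fun τ _ => ?_
      rw [mul_comm]
      rfl
    have h2 := (linearIndependent_monoidHom L L).comp
      (fun τ : L ≃ₐ[F] L => ((τ : L →+* L) : L →* L)) (by
        intro σ τ h
        ext x
        exact DFunLike.congr_fun h x)
    rw [Fintype.linearIndependent_iff] at h2
    funext τ
    apply Subtype.ext
    refine h2 (fun τ => (y τ : L)) ?_ τ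
    funext x
    rw [Finset.sum_apply]
    simp only [Pi.zero_apply]
    rw [← h1 x]
    refine Finset.sum_congr rfl fun τ _ => ?_
    rw [mul_comm]
    rfl
  · exact fun x y n => StW_add _ _ _
  · exact fun x y m n => StW_mul _ _ _ _
  · exact fun x m n => StW_mono _ _ _
  · intro σ x n h
    rw [integralClosure.coe_smul]
    refine StW_map (σ : L →+* L) ?_ _ _ h
    intro P
    change σ _ = _
    rw [IsScalarTower.algebraMap_apply O[X] F L, AlgEquiv.commutes]
  · exact fun c => StW_const c
  · exact fun P n h => StW_deg hinj P n h
  · rw [← Nat.card_eq_fintype_card (α := L ≃ₐ[F] L), IsGalois.card_aut_eq_finrank,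
      Module.finrank_eq_card_basis b]

end setup

section frob
set_option linter.unusedSectionVars false

theorem st_frob {O R : Type*} (G : Type*) [CommRing O] [CommRing R] [Algebra O[X] R] [Group G]
    [Finite G] [MulSemiringAction G R] [SMulCommClass G O[X] R] [Algebra.IsInvariant O[X] R G]
    [Module.Finite O[X] R] (hinj : Function.Injective (algebraMap O[X] R))
    (p : Ideal O) [p.IsMaximal] [Finite (O ⧸ p)] (a : O ⧸ p) :
    ∃ (Q : Ideal R) (σ : G), Q.IsPrime ∧
      (∀ f, algebraMap O[X] R f ∈ Q ↔ (f.map (Ideal.Quotient.mk p)).eval a = 0) ∧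
      ∀ x : R, σ • x - x ^ Nat.card (O ⧸ p) ∈ Q := by
  let φ : O[X] →+* O ⧸ p := (evalRingHom a).comp (mapRingHom (Ideal.Quotient.mk p))
  have hφ : Function.Surjective φ := by
    intro b
    obtain ⟨c, rfl⟩ := Ideal.Quotient.mk_surjective b
    exact ⟨C c, by simp [φ]⟩
  let _ : Field (O ⧸ p) := Ideal.Quotient.field p
  have hmax : (RingHom.ker φ).IsMaximal := RingHom.ker_isMaximal_of_surjective φ hφ
  obtain ⟨Q, hQ, hQP⟩ := Ideal.exists_ideal_over_maximal_of_isIntegral (S := R) (RingHom.ker φ)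
    (by rw [(RingHom.injective_iff_ker_eq_bot _).mp hinj]; exact bot_le)
  have hQu : Q.under O[X] = RingHom.ker φ := hQP
  let eq : (O[X] ⧸ Q.under O[X]) ≃+* O ⧸ p :=
    (Ideal.quotEquivOfEq hQu).trans (RingHom.quotientKerEquivOfSurjective hφ)
  have hcard : Nat.card (O[X] ⧸ Q.under O[X]) = Nat.card (O ⧸ p) := Nat.card_congr eq.toEquiv
  have hfin : Finite (O[X] ⧸ Q.under O[X]) := Finite.of_equiv _ eq.symm.toEquiv
  have hmf : Module.Finite (O[X] ⧸ Q.under O[X]) (R ⧸ Q) := by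
    have : Module.Finite O[X] (R ⧸ Q) := inferInstance
    exact Module.Finite.of_restrictScalars_finite O[X] _ _
  have : Finite (R ⧸ Q) := Module.finite_of_finite (O[X] ⧸ Q.under O[X])
  have hQp : Q.IsPrime := hQ.isPrime
  obtain ⟨σ, hσ⟩ := IsArithFrobAt.exists_of_isInvariant O[X] G Q
  refine ⟨Q, σ, hQp, ?_, ?_⟩
  · intro f
    change f ∈ Q.comap (algebraMap O[X] R) ↔ _
    rw [hQP]
    rfl
  · intro x
    have := hσ x
    rw [hcard] at this
    exact this

end frob

section main
set_option linter.unusedSectionVars false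

variable {O L : Type*} [CommRing O] [Field L] [Algebra O[X] L] [Algebra O L]
  [IsScalarTower O O[X] L] [IsDomain O] [CharZero O]

theorem st_main (F : Type*) [Field F] [Algebra O[X] F] [IsFractionRing O[X] F] [Algebra F L]
    [FiniteDimensional F L] [IsGalois F L] [IsScalarTower O[X] F L]
    [IsIntegrallyClosed O[X]] [IsNoetherianRing O] [Fintype (L ≃ₐ[F] L)]
    (hK : ∀ x : L, IsAlgebraic O x → ∃ a b : O, b ≠ 0 ∧ algebraMap O L b * x = algebraMap O L a)
    (g : O[X]) (hg : 0 < g.natDegree) (H : O[X][X]) (hH : H = g.map C - C X)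
    (hs : (H.map (algebraMap O[X] L)).Splits) (T : Finset (L ≃ₐ[F] L))
    (hT : ∀ σ, σ ∈ T ↔ ∃ x : L, aeval x H = 0 ∧ σ x = x) (ε : ℝ) (hε : 0 < ε) :
    ∃ β : O[X], β ≠ 0 ∧ ∃ N : ℝ, ∀ (p : Ideal O) [p.IsMaximal] [Finite (O ⧸ p)],
      β.map (Ideal.Quotient.mk p) ≠ 0 → ∀ s : Finset (O ⧸ p),
      (∀ a ∈ s, ∃ b, (g.map (Ideal.Quotient.mk p)).eval b = a) →
      (s.card : ℝ) ≤ (T.card / Fintype.card (L ≃ₐ[F] L) + ε) * Nat.card (O ⧸ p) + N := by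
  classical
  have hinj := st_inj (O := O) (L := L) F
  have hinjR : Function.Injective (algebraMap O[X] (integralClosure O[X] L)) := by
    intro x y hxy
    exact hinj (congrArg Subtype.val hxy)
  have hinv := st_invariant (O := O) (L := L) F
  have hfinR := IsIntegralClosure.finite O[X] F L (integralClosure O[X] L)
  have hfix : ∀ (σ : L ≃ₐ[F] L) P, σ (algebraMap O[X] L P) = algebraMap O[X] L P := by
    intro σ P
    rw [IsScalarTower.algebraMap_apply O[X] F L, AlgEquiv.commutes]
  obtain ⟨ι, S, hcard⟩ := st_setup (O := O) (L := L) F hK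
  have hTc : ∀ σ ∈ T, ∀ τ, τ⁻¹ * σ * τ ∈ T := by
    intro σ hσ τ
    rw [hT] at hσ ⊢
    obtain ⟨x, hx, hxσ⟩ := hσ
    refine ⟨τ⁻¹ x, ?_, ?_⟩
    · have h1 : aeval (τ⁻¹ x) H = τ⁻¹ (aeval x H) := by
        simp only [aeval_def]
        have h2 := hom_eval₂ H (algebraMap O[X] L) ((τ⁻¹ : L ≃ₐ[F] L) : L →+* L) x
        have h3 : (((τ⁻¹ : L ≃ₐ[F] L) : L →+* L)).comp (algebraMap O[X] L) = algebraMap O[X] L :=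
          RingHom.ext fun P => hfix τ⁻¹ P
        rw [h3] at h2
        exact h2.symm
      rw [h1, hx, map_zero]
    · change τ⁻¹ (σ (τ (τ⁻¹ x))) = τ⁻¹ x
      have : τ (τ⁻¹ x) = x := by
        change (τ * τ⁻¹) x = x
        rw [mul_inv_cancel]; rfl
      rw [this, hxσ]
  obtain ⟨β, hβ, N, hN⟩ := S.count hcard T hTc ε hε
  -- roots
  have hdeg : H.natDegree = g.natDegree := by
    rw [hH, natDegree_sub_C, natDegree_map_eq_of_injective C_injective]
  have hlc : H.leadingCoeff = C g.leadingCoeff := by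
    rw [leadingCoeff, hdeg, hH, coeff_sub, coeff_map, coeff_C_of_ne_zero (by omega), sub_zero]
    rfl
  have hg0 : g ≠ 0 := by
    rintro rfl
    simp at hg
  have hH0 : H ≠ 0 := by
    rintro rfl
    rw [natDegree_zero] at hdeg
    omega
  have hHL0 : H.map (algebraMap O[X] L) ≠ 0 := by
    rwa [Ne, Polynomial.map_eq_zero_iff hinj]
  set ℓ : L := algebraMap O[X] L (C g.leadingCoeff) with hℓ
  have hℓ0 : ℓ ≠ 0 := by
    rw [hℓ, Ne, map_eq_zero_iff _ hinj, C_eq_zero, leadingCoeff_eq_zero]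
    exact hg0
  have hroot : ∀ x ∈ (H.map (algebraMap O[X] L)).roots, aeval x H = 0 := by
    intro x hx
    rw [mem_roots hHL0, IsRoot, eval_map] at hx
    exact hx
  obtain ⟨M, hM⟩ : ∃ M : Multiset (integralClosure O[X] L),
      M.map (Subtype.val) = (H.map (algebraMap O[X] L)).roots.map (fun x => ℓ * x) := by
    have hIntegral : ∀ z ∈ (H.map (algebraMap O[X] L)).roots.map (fun x => ℓ * x),
        z ∈ integralClosure O[X] L := by
      intro z hz
      obtain ⟨x, hx, rfl⟩ := Multiset.mem_map.1 hz
      have := isIntegral_leadingCoeff_smul H x (hroot x hx)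
      rw [hlc, Algebra.smul_def] at this
      exact this
    refine ⟨((H.map (algebraMap O[X] L)).roots.map (fun x => ℓ * x)).pmap
      (fun z hz => (⟨z, hz⟩ : integralClosure O[X] L)) hIntegral, ?_⟩
    rw [Multiset.map_pmap, Multiset.pmap_eq_map, Multiset.map_id']
  let y : integralClosure O[X] L := ∏ τ : L ≃ₐ[F] L, ∏ m ∈ M.toFinset,
    if τ • m = m then 1 else τ • m - m
  have hy : y ≠ 0 := by
    refine Finset.prod_ne_zero_iff.2 fun τ _ => Finset.prod_ne_zero_iff.2 fun m _ => ?_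
    split_ifs with h
    · exact one_ne_zero
    · exact sub_ne_zero.2 h
  obtain ⟨P, z, hP, hPz⟩ := S.exists_norm y hy
  refine ⟨β * P, mul_ne_zero hβ hP, N + (β * P).natDegree, ?_⟩
  intro p hp hfin hne s hs'
  let _ : Field (O ⧸ p) := Ideal.Quotient.field p
  rw [Polynomial.map_mul] at hne
  choose Q σ hQp hQ hσ using fun a => st_frob (L ≃ₐ[F] L) hinjR p a
  let bad := ((β * P).map (Ideal.Quotient.mk p)).roots.toFinset
  have hbad : bad.card ≤ (β * P).natDegree :=
    (Multiset.toFinset_card_le _).trans ((card_roots' _).trans natDegree_map_le)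
  have hmain := hN p (left_ne_zero_of_mul hne) (s \ bad) Q σ ?_
  · have h1 : s.card ≤ (s \ bad).card + bad.card := by
      have := Finset.le_card_sdiff bad s
      omega
    have h2 : (s.card : ℝ) ≤ (s \ bad).card + (β * P).natDegree := by
      exact_mod_cast h1.trans (Nat.add_le_add_left hbad _)
    linarith
  intro a ha
  rw [Finset.mem_sdiff] at ha
  obtain ⟨has, hab⟩ := ha
  have hab' : ((β * P).map (Ideal.Quotient.mk p)).eval a ≠ 0 := by
    intro h
    apply hab
    rw [Multiset.mem_toFinset, mem_roots (by rwa [Polynomial.map_mul])]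
    exact h
  rw [Polynomial.map_mul, eval_mul] at hab'
  refine ⟨hQ a, hσ a, left_ne_zero_of_mul hab', ?_⟩
  have hPa := right_ne_zero_of_mul hab'
  obtain ⟨b, hb⟩ := hs' a has
  obtain ⟨b, rfl⟩ := Ideal.Quotient.mk_surjective b
  have hQa := hQp a
  -- product
  have hD : Multiset.card (H.map (algebraMap O[X] L)).roots = g.natDegree := by
    rw [← hs.natDegree_eq_card_roots, natDegree_map_eq_of_injective hinj, hdeg]
  have hprod : (M.map (fun m => algebraMap O[X] _ (C (g.leadingCoeff * b)) - m)).prod =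
      algebraMap O[X] _ (C g.leadingCoeff ^ (g.natDegree - 1) * (C (g.eval b) - X)) := by
    apply Subtype.ext
    have e1 : ((M.map (fun m => algebraMap O[X] (integralClosure O[X] L) (C (g.leadingCoeff * b)) - m)).prod : L)
        = ((M.map Subtype.val).map (fun m => algebraMap O[X] L (C (g.leadingCoeff * b)) - m)).prod := by
      rw [← Subalgebra.coe_val, map_multiset_prod, Multiset.map_map, Multiset.map_map]
      rfl
    change _ = algebraMap O[X] L _
    rw [e1, hM, Multiset.map_map]
    have e2 : ((fun m => algebraMap O[X] L (C (g.leadingCoeff * b)) - m) ∘ fun x => ℓ * x) =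
        fun x => ℓ * (algebraMap O[X] L (C b) - x) := by
      funext x
      simp only [Function.comp, map_mul, ← hℓ]
      ring
    rw [e2, Multiset.prod_map_mul, Multiset.map_const', Multiset.prod_replicate, hD]
    have e3 := congrArg (fun q => q.eval (algebraMap O[X] L (C b))) hs.eq_prod_roots
    simp only [eval_mul, eval_C, eval_multiset_prod, Multiset.map_map] at e3
    rw [leadingCoeff_map_of_injective hinj, hlc, ← hℓ] at e3
    have e4 : (H.map (algebraMap O[X] L)).eval (algebraMap O[X] L (C b)) =
        algebraMap O[X] L (C (g.eval b) - X) := by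
      rw [eval_map_algebraMap, aeval_algebraMap_apply, hH]
      congr 1
      simp [eval_map, eval₂_at_apply]
    rw [e4] at e3
    have e5 : (fun a => eval (algebraMap O[X] L (C b)) (X - C a)) =
      fun x => algebraMap O[X] L (C b) - x := by
      funext x
      simp
    rw [map_mul, map_pow, e3, ← hℓ, ← mul_assoc, ← pow_succ, Nat.sub_add_cancel hg]
    congr 3
    exact e5.symm
  have hmem : (M.map (fun m => algebraMap O[X] _ (C (g.leadingCoeff * b)) - m)).prod ∈ Q a := by
    rw [hprod, hQ a]
    simp only [Polynomial.map_mul, Polynomial.map_sub, map_C, map_X, eval_mul, eval_sub, eval_C,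
      eval_X]
    rw [eval_map, eval₂_at_apply] at hb
    rw [hb, sub_self, mul_zero]
  rw [hQa.multiset_prod_mem_iff_exists_mem] at hmem
  obtain ⟨_, hm1, hm2⟩ := hmem
  obtain ⟨m, hm, rfl⟩ := Multiset.mem_map.1 hm1
  obtain ⟨x, hx, hxm⟩ : ∃ x ∈ (H.map (algebraMap O[X] L)).roots, ℓ * x = (m : L) := by
    have : (m : L) ∈ M.map Subtype.val := Multiset.mem_map_of_mem _ hm
    rw [hM] at this
    exact Multiset.mem_map.1 this
  have hσm : σ a • m - m ∈ Q a := by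
    have h1 := hσ a m
    set u := algebraMap O[X] (integralClosure O[X] L) (C (g.leadingCoeff * b)) with hu
    have h2 : u ^ Nat.card (O ⧸ p) - m ^ Nat.card (O ⧸ p) ∈ Q a :=
      Ideal.mem_of_dvd _ (sub_dvd_pow_sub_pow u m _) hm2
    have h3 : u ^ Nat.card (O ⧸ p) - u ∈ Q a := by
      have := Fintype.ofFinite (O ⧸ p)
      rw [hu, ← map_pow, ← map_sub, hQ a, ← C_pow, ← C_sub, map_C, eval_C, map_sub, map_pow,
        Nat.card_eq_fintype_card, FiniteField.pow_card, sub_self]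
    have h4 : σ a • m - m = (σ a • m - m ^ Nat.card (O ⧸ p)) -
      (u ^ Nat.card (O ⧸ p) - m ^ Nat.card (O ⧸ p)) + (u ^ Nat.card (O ⧸ p) - u) + (u - m) := by
      ring
    rw [h4]
    exact add_mem (add_mem (sub_mem h1 h2) h3) hm2
  have hfixm : σ a • m = m := by
    by_contra hne'
    apply hPa
    rw [← hQ a, hPz]
    apply Ideal.mul_mem_right
    have hd : σ a • m - m ∣ y := by
      have d1 : (if σ a • m = m then 1 else σ a • m - m) ∣
          ∏ m ∈ M.toFinset, if σ a • m = m then 1 else σ a • m - m :=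
        Finset.dvd_prod_of_mem (fun m => if σ a • m = m then 1 else σ a • m - m)
          (Multiset.mem_toFinset.2 hm)
      rw [if_neg hne'] at d1
      exact d1.trans (Finset.dvd_prod_of_mem (fun τ : L ≃ₐ[F] L => ∏ m ∈ M.toFinset,
        if τ • m = m then 1 else τ • m - m) (Finset.mem_univ (σ a)))
    exact Ideal.mem_of_dvd _ hd hσm
  rw [hT]
  refine ⟨x, hroot x hx, ?_⟩
  have h5 := congrArg Subtype.val hfixm
  rw [integralClosure.coe_smul, ← hxm] at h5
  change σ a (ℓ * x) = ℓ * x at h5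
  rw [map_mul, hℓ, hfix, ← hℓ] at h5
  exact mul_left_cancel₀ hℓ0 h5

end main

theorem st_concrete {K : Type*} [Field K] [NumberField K] (L : Type*) [Field L]
    [Algebra (RatFunc K) L] [FiniteDimensional (RatFunc K) L] [IsGalois (RatFunc K) L]
    [Fintype (L ≃ₐ[RatFunc K] L)]
    (halg : ∀ x : L, (∃ g : K[X], g ≠ 0 ∧
      eval₂ ((algebraMap (RatFunc K) L).comp (algebraMap K (RatFunc K))) x g = 0) →
      x ∈ Set.range ((algebraMap (RatFunc K) L).comp (algebraMap K (RatFunc K))))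
    (g : (𝓞 K)[X]) (hg : 0 < g.natDegree) (h : (RatFunc K)[X])
    (hh : h = g.map ((algebraMap K (RatFunc K)).comp (algebraMap (𝓞 K) K)) - C RatFunc.X)
    (hs : (h.map (algebraMap (RatFunc K) L)).Splits) (T : Finset (L ≃ₐ[RatFunc K] L))
    (hT : ∀ σ, σ ∈ T ↔ ∃ x : L, aeval x h = 0 ∧ σ x = x) (ε : ℝ) (hε : 0 < ε) :
    ∃ β : (𝓞 K)[X], β ≠ 0 ∧ ∃ N : ℝ, ∀ (p : Ideal (𝓞 K)) [p.IsMaximal] [Finite (𝓞 K ⧸ p)],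
      β.map (Ideal.Quotient.mk p) ≠ 0 → ∀ s : Finset (𝓞 K ⧸ p),
      (∀ a ∈ s, ∃ b, (g.map (Ideal.Quotient.mk p)).eval b = a) →
      (s.card : ℝ) ≤ (T.card / Fintype.card (L ≃ₐ[RatFunc K] L) + ε) * Nat.card (𝓞 K ⧸ p) + N := by
  let iF : Algebra (𝓞 K)[X] (RatFunc K) :=
    ((algebraMap K[X] (RatFunc K)).comp (mapRingHom (algebraMap (𝓞 K) K))).toAlgebra
  let iL : Algebra (𝓞 K)[X] L :=
    ((algebraMap (RatFunc K) L).comp (algebraMap (𝓞 K)[X] (RatFunc K))).toAlgebra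
  let iO : Algebra (𝓞 K) L :=
    ((algebraMap (𝓞 K)[X] L).comp (C : 𝓞 K →+* (𝓞 K)[X])).toAlgebra
  have t1 : IsScalarTower (𝓞 K)[X] (RatFunc K) L := IsScalarTower.of_algebraMap_eq fun x => rfl
  have t2 : IsScalarTower (𝓞 K) (𝓞 K)[X] L := IsScalarTower.of_algebraMap_eq fun x => rfl
  have hFdef : ∀ P : (𝓞 K)[X], algebraMap (𝓞 K)[X] (RatFunc K) P =
    algebraMap K[X] (RatFunc K) (P.map (algebraMap (𝓞 K) K)) := fun P => rfl
  have hOK : Function.Injective (algebraMap (𝓞 K) K) := IsFractionRing.injective (𝓞 K) K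
  have hinjF : Function.Injective (algebraMap (𝓞 K)[X] (RatFunc K)) := by
    intro P Q hPQ
    rw [hFdef, hFdef] at hPQ
    exact map_injective _ hOK (IsFractionRing.injective K[X] (RatFunc K) hPQ)
  have hfs : FaithfulSMul (𝓞 K)[X] (RatFunc K) :=
    (faithfulSMul_iff_algebraMap_injective _ _).2 hinjF
  have hfr : IsFractionRing (𝓞 K)[X] (RatFunc K) := by
    apply IsFractionRing.of_field
    intro z
    obtain ⟨A, B, hB, rfl⟩ := IsFractionRing.div_surjective (A := K[X]) z
    have key : ∀ A : K[X], ∃ (a : 𝓞 K) (A' : (𝓞 K)[X]), a ≠ 0 ∧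
        A'.map (algebraMap (𝓞 K) K) = C (algebraMap (𝓞 K) K a) * A := by
      intro A
      obtain ⟨b, hb⟩ := IsLocalization.integerNormalization_map_to_map (nonZeroDivisors (𝓞 K)) A
      refine ⟨b, _, nonZeroDivisors.ne_zero b.2, hb.trans ?_⟩
      rw [← smul_eq_C_mul, algebraMap_smul]
    obtain ⟨a, A', ha, hA'⟩ := key A
    obtain ⟨b, B', hb, hB'⟩ := key B
    refine ⟨C b * A', C a * B', ?_⟩
    simp only [hFdef, Polynomial.map_mul, hA', hB', map_C, map_mul]
    have ha' : algebraMap K[X] (RatFunc K) (C (algebraMap (𝓞 K) K a)) ≠ 0 := by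
      rw [Ne, map_eq_zero_iff _ (IsFractionRing.injective K[X] (RatFunc K)), C_eq_zero,
        map_eq_zero_iff _ hOK]
      exact ha
    have hb' : algebraMap K[X] (RatFunc K) (C (algebraMap (𝓞 K) K b)) ≠ 0 := by
      rw [Ne, map_eq_zero_iff _ (IsFractionRing.injective K[X] (RatFunc K)), C_eq_zero,
        map_eq_zero_iff _ hOK]
      exact hb
    have hB' : algebraMap K[X] (RatFunc K) B ≠ 0 := by
      rw [Ne, map_eq_zero_iff _ (IsFractionRing.injective K[X] (RatFunc K))]
      exact nonZeroDivisors.ne_zero hB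
    field_simp
  have hOL : ∀ a : 𝓞 K, algebraMap (𝓞 K) L a =
      ((algebraMap (RatFunc K) L).comp (algebraMap K (RatFunc K))) (algebraMap (𝓞 K) K a) := by
    intro a
    change algebraMap (RatFunc K) L (algebraMap (𝓞 K)[X] (RatFunc K) (C a)) = _
    rw [hFdef, map_C, RatFunc.algebraMap_C, RingHom.comp_apply, RatFunc.algebraMap_eq_C]
  have hK : ∀ x : L, IsAlgebraic (𝓞 K) x →
      ∃ a b : 𝓞 K, b ≠ 0 ∧ algebraMap (𝓞 K) L b * x = algebraMap (𝓞 K) L a := by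
    rintro x ⟨P, hP, hPx⟩
    obtain ⟨k, rfl⟩ := halg x ⟨P.map (algebraMap (𝓞 K) K),
      by rwa [Ne, Polynomial.map_eq_zero_iff hOK], by
        rw [eval₂_map]
        rw [aeval_def] at hPx
        rw [← hPx]
        congr 1
        ext a
        exact (hOL a).symm⟩
    obtain ⟨a, b, hb, rfl⟩ := IsFractionRing.div_surjective (A := 𝓞 K) k
    have hb' : algebraMap (𝓞 K) K b ≠ 0 := by
      rw [Ne, map_eq_zero_iff _ hOK]
      exact nonZeroDivisors.ne_zero hb
    refine ⟨a, b, nonZeroDivisors.ne_zero hb, ?_⟩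
    rw [hOL, hOL, ← map_mul, mul_div_cancel₀ _ hb']
  have hHh : ((g.map C - C X : (𝓞 K)[X][X])).map (algebraMap (𝓞 K)[X] (RatFunc K)) = h := by
    rw [hh, Polynomial.map_sub, Polynomial.map_map, map_C, hFdef, map_X, RatFunc.algebraMap_X]
    congr 2
    ext a
    simp only [RingHom.comp_apply]
    rw [hFdef, map_C, RatFunc.algebraMap_C, RatFunc.algebraMap_eq_C]
  refine st_main (RatFunc K) hK g hg _ rfl ?_ T ?_ ε hε
  · rw [IsScalarTower.algebraMap_eq (𝓞 K)[X] (RatFunc K) L, ← Polynomial.map_map, hHh]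
    exact hs
  · intro σ
    rw [hT, ← hHh]
    simp only [aeval_map_algebraMap]

theorem st_iter_eval {R S : Type*} [CommRing R] [CommRing S] (φ : R →+* S) (f : R[X]) (n : ℕ) (b : S) :
    (((fun g => f.comp g)^[n] X).map φ).eval b = (fun w => (f.map φ).eval w)^[n] b := by
  induction n with
  | zero => simp
  | succ n ih =>
    rw [Function.iterate_succ_apply', Function.iterate_succ_apply', Polynomial.map_comp, eval_comp, ih]

/-- Let `f ∈ 𝓞_K[x]` of degree `d ≥ 2`, `n ≥ 1`, `K_n` a splitting
field of `f^{∘n}(x) − t` over `K(t)` and `G_n` its Galois group, acting on the roots of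
`f^{∘n}(x) − t`.  If `K` is algebraically closed in `K_n`, then for every `δ > 0` there
is `M` such that all primes `𝔭` with `N(𝔭) > M` avoiding the leading coefficient of `f`
satisfy `#Per(f_𝔭) + 1 ≤ (FPP(G_n) + δ)(N(𝔭) + 1)`. -/
theorem per_le_FPP_of_large_norm {K : Type*} [Field K] [NumberField K]
    (f : Polynomial (𝓞 K)) (d : ℕ) (hd : 2 ≤ d) (hdeg : f.natDegree = d)
    (n : ℕ) (hn : 1 ≤ n)
    (halg : ∀ x : (iterMinusT K f n).SplittingField,
      (∃ g : Polynomial K, g ≠ 0 ∧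
        Polynomial.eval₂ (constEmb K (iterMinusT K f n)) x g = 0) →
      x ∈ Set.range (constEmb K (iterMinusT K f n))) :
    ∀ δ : ℝ, 0 < δ → ∃ M : ℝ,
      ∀ 𝔭 : Ideal (𝓞 K), 𝔭.IsPrime → 𝔭 ≠ ⊥ → M < (Ideal.absNorm 𝔭 : ℝ) →
        f.leadingCoeff ∉ 𝔭 →
        (perCount f 𝔭 : ℝ) + 1 ≤
          (FPP (iterMinusT K f n) + δ) * ((Ideal.absNorm 𝔭 : ℝ) + 1) := by
  classical
  intro δ hδ
  let L := (iterMinusT K f n).SplittingField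
  let g : (𝓞 K)[X] := (fun g => f.comp g)^[n] X
  have hg : 0 < g.natDegree := by
    have : g.natDegree = f.natDegree ^ n * (X : (𝓞 K)[X]).natDegree :=
      natDegree_iterate_comp n
    rw [this, natDegree_X, mul_one, hdeg]
    exact Nat.pow_pos (by omega)
  haveI hgal : IsGalois (RatFunc K) L :=
    IsGalois.mk
  letI : Fintype (L ≃ₐ[RatFunc K] L) := Fintype.ofFinite _
  let T : Finset (L ≃ₐ[RatFunc K] L) :=
    Finset.univ.filter fun σ => ∃ x : L, aeval x (iterMinusT K f n) = 0 ∧ σ x = x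
  obtain ⟨β, hβ, N, hN⟩ := st_concrete L halg g hg (iterMinusT K f n) rfl
    (SplittingField.splits _) T (by simp [T]) (δ / 2) (by linarith)
  have hFPP : FPP (iterMinusT K f n) = T.card / Fintype.card (L ≃ₐ[RatFunc K] L) := by
    unfold FPP
    congr 2
    · rw [← Nat.subtype_card T (p := fun σ : L ≃ₐ[RatFunc K] L =>
        ∃ x : L, aeval x (iterMinusT K f n) = 0 ∧ σ x = x) (by simp [T])]
      rfl
    · rw [← Nat.card_eq_fintype_card]
      rfl
  have hFPP0 : 0 ≤ FPP (iterMinusT K f n) := by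
    rw [hFPP]
    positivity
  obtain ⟨i, hi⟩ : ∃ i, β.coeff i ≠ 0 := by
    by_contra! h
    exact hβ (Polynomial.ext fun i => by simpa using h i)
  refine ⟨max (2 * (N + 1) / δ) (Ideal.absNorm (Ideal.span {β.coeff i})), ?_⟩
  intro 𝔭 hp hp0 hM _
  haveI hmax : 𝔭.IsMaximal := hp.isMaximal hp0
  haveI hfin : Finite (𝓞 K ⧸ 𝔭) := Ideal.finiteQuotientOfFreeOfNeBot 𝔭 hp0
  have hcard : Ideal.absNorm 𝔭 = Nat.card (𝓞 K ⧸ 𝔭) := by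
    rw [Ideal.absNorm_apply, Submodule.cardQuot_apply]
  have hM1 := lt_of_le_of_lt (le_max_left _ _) hM
  have hM2 := lt_of_le_of_lt (le_max_right _ _) hM
  have hβp : β.map (Ideal.Quotient.mk 𝔭) ≠ 0 := by
    intro h
    have h1 : Ideal.Quotient.mk 𝔭 (β.coeff i) = 0 := by
      rw [← coeff_map, h, coeff_zero]
    rw [Ideal.Quotient.eq_zero_iff_mem] at h1
    have h2 : Ideal.span {β.coeff i} ≤ 𝔭 := by
      rwa [Ideal.span_singleton_le_iff_mem]
    have h3 := Ideal.absNorm_dvd_absNorm_of_le h2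
    have h4 : 0 < Ideal.absNorm (Ideal.span {β.coeff i}) := by
      rw [Nat.pos_iff_ne_zero, Ne, Ideal.absNorm_eq_zero_iff, Ideal.span_singleton_eq_bot]
      exact hi
    have h5 := Nat.le_of_dvd h4 h3
    have h6 : Ideal.absNorm (Ideal.span {β.coeff i}) < Ideal.absNorm 𝔭 := by exact_mod_cast hM2
    omega
  let P : Set (𝓞 K ⧸ 𝔭) := {z | ∃ m : ℕ, 0 < m ∧
    (fun w => (f.map (Ideal.Quotient.mk 𝔭)).eval w)^[m] z = z}
  have hPfin : P.Finite := Set.toFinite P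
  have hper : perCount f 𝔭 = hPfin.toFinset.card := Set.ncard_eq_toFinset_card P hPfin
  have hmain := hN 𝔭 hβp hPfin.toFinset ?_
  · rw [← hper, ← hFPP, ← hcard] at hmain
    have h1 : N + 1 ≤ δ / 2 * Ideal.absNorm 𝔭 := by
      rw [div_lt_iff₀ hδ] at hM1
      linarith
    nlinarith
  · intro a ha
    rw [Set.Finite.mem_toFinset] at ha
    obtain ⟨m, hm, hma⟩ := ha
    refine ⟨(fun w => (f.map (Ideal.Quotient.mk 𝔭)).eval w)^[n * (m - 1)] a, ?_⟩
    rw [st_iter_eval, ← Function.iterate_add_apply]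
    have h1 : n + n * (m - 1) = m * n := by
      obtain ⟨k, rfl⟩ := Nat.exists_eq_add_of_le' hm
      simp only [Nat.add_sub_cancel]
      ring
    rw [h1, Function.iterate_mul]
    exact Function.iterate_fixed hma n
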